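/- arXiv:2202.05419 — 2 statements merged into one kernel-verified Lean document; each statement's English description precedes it below -/
import Mathlib

section
/- Moment generating function bound for the difference of projected quadratic forms: let X be a real n×p matrix, let S, S* ⊆ {1,…,p}, let P_S, P_{S*}, P_{S∩S*} denote the orthogonal projections onto the column spans of X_S, X_{S*}, X_{S∩S*} respectively, and assume the columns of X_S indexed by any subset are linearly independent so that rank(P_S − P_{S∩S*}) = |S| − |S∩S*|. Let y = Xβ* + σ₀ε with ε ~ N_n(0, I_n), σ₀ > 0, and β* ∈ ℝ^p supported on S*. Then for every 0 < l < 1: E[exp{(l/(2σ₀²))·yᵀ(P_S − P_{S*})y}] ≤ (1−l)^{−(|S| − |S∩S*|)/2} · exp{−(l(1−l)/(2σ₀²))·‖(I−P_S)Xβ*‖²}. -/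
open MeasureTheory ProbabilityTheory Matrix Real

noncomputable section

/-- Submatrix of columns of `X` indexed by `S`. -/
def colsSub {n p : ℕ} (X : Matrix (Fin n) (Fin p) ℝ) (S : Finset (Fin p)) :
    Matrix (Fin n) {j // j ∈ S} ℝ := Matrix.of fun i j => X i j.1

/-- Orthogonal projection `P_S = X_S(X_SᵀX_S)⁻¹X_Sᵀ` onto the column span of `X_S`. -/
def projMat {n p : ℕ} (X : Matrix (Fin n) (Fin p) ℝ) (S : Finset (Fin p)) :
    Matrix (Fin n) (Fin n) ℝ :=
  colsSub X S * ((colsSub X S)ᵀ * colsSub X S)⁻¹ * (colsSub X S)ᵀ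

section Projections

variable {ι : Type*} [Fintype ι]

lemma dotProduct_mulVec_symm {A : Matrix ι ι ℝ} (hA : Aᵀ = A) (v w : ι → ℝ) :
    v ⬝ᵥ A *ᵥ w = A *ᵥ v ⬝ᵥ w := by
  rw [dotProduct_mulVec, ← mulVec_transpose, hA]

lemma dotProduct_mulVec_self_eq {A : Matrix ι ι ℝ} (hA : Aᵀ = A) (hA2 : A * A = A) (v : ι → ℝ) :
    v ⬝ᵥ A *ᵥ v = A *ᵥ v ⬝ᵥ A *ᵥ v := by
  rw [← dotProduct_mulVec_symm hA, mulVec_mulVec, hA2]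

lemma dotProduct_self_nonneg_real (v : ι → ℝ) : 0 ≤ v ⬝ᵥ v :=
  Finset.sum_nonneg fun i _ => mul_self_nonneg (v i)

lemma projection_dotProduct_nonneg {A : Matrix ι ι ℝ} (hA : Aᵀ = A) (hA2 : A * A = A)
    (v : ι → ℝ) : 0 ≤ v ⬝ᵥ A *ᵥ v := by
  rw [dotProduct_mulVec_self_eq hA hA2]
  exact dotProduct_self_nonneg_real _

variable [DecidableEq ι]

lemma one_sub_mul_self {A : Matrix ι ι ℝ} (hA2 : A * A = A) : (1 - A) * (1 - A) = 1 - A := by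
  simp [sub_mul, mul_sub, hA2]

lemma projection_dotProduct_le {A : Matrix ι ι ℝ} (hA : Aᵀ = A) (hA2 : A * A = A)
    (v : ι → ℝ) : v ⬝ᵥ A *ᵥ v ≤ v ⬝ᵥ v := by
  have h := projection_dotProduct_nonneg (by simp [hA]) (one_sub_mul_self hA2) v
  simp only [sub_mulVec, one_mulVec, dotProduct_sub] at h
  linarith

/-- `1 - l(A - B)` dominates `1 - l`, hence is surjective. -/
lemma exists_mulVec_one_sub_smul_sub_eq {A B : Matrix ι ι ℝ} (hA : Aᵀ = A) (hA2 : A * A = A)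
    (hB : Bᵀ = B) (hB2 : B * B = B) {l : ℝ} (hl0 : 0 < l) (hl1 : l < 1) (w : ι → ℝ) :
    ∃ v, (1 - l • (A - B)) *ᵥ v = w := by
  have hinj : Function.Injective (1 - l • (A - B)).mulVec := by
    intro v₁ v₂ h
    have hz : (1 - l • (A - B)) *ᵥ (v₁ - v₂) = 0 := by rw [mulVec_sub, h, sub_self]
    set u := v₁ - v₂ with hu
    have h0 : u ⬝ᵥ (1 - l • (A - B)) *ᵥ u = 0 := by rw [hz, dotProduct_zero]
    simp only [sub_mulVec, one_mulVec, dotProduct_sub, smul_mulVec, dotProduct_smul,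
      smul_eq_mul] at h0
    have h1 := projection_dotProduct_le hA hA2 u
    have h2 := projection_dotProduct_nonneg hB hB2 u
    have h3 := dotProduct_self_nonneg_real u
    have h4 : u ⬝ᵥ u = 0 := by nlinarith
    exact sub_eq_zero.mp (dotProduct_self_eq_zero.mp h4)
  obtain ⟨v, hv⟩ := mulVec_surjective_iff_isUnit.mpr (mulVec_injective_iff_isUnit.mp hinj) w
  exact ⟨v, hv⟩

lemma quadratic_sub_le {A B : Matrix ι ι ℝ} (hA : Aᵀ = A) (hA2 : A * A = A)
    (hB : Bᵀ = B) (hB2 : B * B = B) {m : ι → ℝ} (hm : B *ᵥ m = m)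
    {l : ℝ} (hl0 : 0 < l) (hl1 : l < 1) (x : ι → ℝ) :
    l * ((m + x) ⬝ᵥ (A - B) *ᵥ (m + x)) - x ⬝ᵥ x ≤
      -(l * (1 - l)) * ((1 - A) *ᵥ m ⬝ᵥ (1 - A) *ᵥ m) := by
  have hBm : B *ᵥ x ⬝ᵥ m = x ⬝ᵥ m := by rw [← dotProduct_mulVec_symm hB, hm]
  have hBpos := projection_dotProduct_nonneg hB hB2 x
  have hAx := projection_dotProduct_nonneg hA hA2 x
  have hsq := projection_dotProduct_nonneg (by simp [hA]) (one_sub_mul_self hA2)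
    (x + l • m)
  rw [← dotProduct_mulVec_self_eq (by simp [hA]) (one_sub_mul_self hA2)]
  have c1 : m ⬝ᵥ A *ᵥ x = x ⬝ᵥ A *ᵥ m := by
    rw [dotProduct_mulVec_symm hA, dotProduct_comm]
  have c2 : m ⬝ᵥ B *ᵥ x = x ⬝ᵥ m := by rw [dotProduct_comm, hBm]
  have c3 : m ⬝ᵥ x = x ⬝ᵥ m := dotProduct_comm _ _
  simp only [sub_mulVec, one_mulVec, dotProduct_sub, mulVec_add, dotProduct_add, add_dotProduct,
    mulVec_smul, dotProduct_smul, smul_dotProduct, smul_eq_mul, hm, c1, c2, c3] at hsq ⊢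
  nlinarith

/-- Completing the square in the exponent of the moment generating function. -/
lemma exists_quadratic_sub_le {A B P : Matrix ι ι ℝ} (hA : Aᵀ = A) (hA2 : A * A = A)
    (hB : Bᵀ = B) (hB2 : B * B = B) (hP : Pᵀ = P) (hP2 : P * P = P)
    (hAP : A * P = P) (hBP : B * P = P) {m : ι → ℝ} (hm : B *ᵥ m = m)
    {l : ℝ} (hl0 : 0 < l) (hl1 : l < 1) :
    ∃ x₀, ∀ x, l * ((m + x) ⬝ᵥ (A - B) *ᵥ (m + x)) - x ⬝ᵥ x ≤
      -(l * (1 - l)) * ((1 - A) *ᵥ m ⬝ᵥ (1 - A) *ᵥ m) -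
        (1 - (1 - √(1 - l)) • (A - P)) *ᵥ (x - x₀) ⬝ᵥ
          (1 - (1 - √(1 - l)) • (A - P)) *ᵥ (x - x₀) := by
  obtain ⟨x₀, hx₀⟩ :=
    exists_mulVec_one_sub_smul_sub_eq hA hA2 hB hB2 hl0 hl1 (l • (A - B) *ᵥ m)
  refine ⟨x₀, fun x => ?_⟩
  obtain ⟨v, rfl⟩ : ∃ v, x = x₀ + v := ⟨x - x₀, by simp⟩
  have hbound := quadratic_sub_le hA hA2 hB hB2 hm hl0 hl1 x₀
  set K := -(l * (1 - l)) * ((1 - A) *ᵥ m ⬝ᵥ (1 - A) *ᵥ m)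
  rw [add_sub_cancel_left]
  have hPA : P * A = P := by simpa [hA, hP] using congrArg transpose hAP
  have hPB : P * B = P := by simpa [hB, hP] using congrArg transpose hBP
  have hQ : (A - P)ᵀ = A - P := by simp [hA, hP]
  have hQ2 : (A - P) * (A - P) = A - P := by simp [sub_mul, mul_sub, hA2, hP2, hAP, hPA]
  have hBPnonneg := projection_dotProduct_nonneg (A := B - P) (by simp [hB, hP])
    (by simp [sub_mul, mul_sub, hB2, hP2, hBP, hPB]) v
  have hQself := dotProduct_mulVec_self_eq hQ hQ2 v
  have hs : √(1 - l) * √(1 - l) = 1 - l := Real.mul_self_sqrt (by linarith)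
  have hR : (1 - (1 - √(1 - l)) • (A - P)) *ᵥ v ⬝ᵥ (1 - (1 - √(1 - l)) • (A - P)) *ᵥ v =
      v ⬝ᵥ v - l * (v ⬝ᵥ (A - P) *ᵥ v) := by
    have hc : (A - P) *ᵥ v ⬝ᵥ v = v ⬝ᵥ (A - P) *ᵥ v := dotProduct_comm _ _
    generalize A - P = Q at *
    simp only [sub_mulVec, one_mulVec, dotProduct_sub, sub_dotProduct, smul_mulVec,
      dotProduct_smul, smul_dotProduct, smul_eq_mul, hc, ← hQself]
    linear_combination (v ⬝ᵥ Q *ᵥ v) * hs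
  rw [hR]
  have hD : (A - B)ᵀ = A - B := by simp [hA, hB]
  have h0 := congrArg (fun z => v ⬝ᵥ z) hx₀
  have c1 : x₀ ⬝ᵥ (A - B) *ᵥ v = v ⬝ᵥ (A - B) *ᵥ x₀ := by
    rw [dotProduct_mulVec_symm hD, dotProduct_comm]
  have c2 : m ⬝ᵥ (A - B) *ᵥ v = v ⬝ᵥ (A - B) *ᵥ m := by
    rw [dotProduct_mulVec_symm hD, dotProduct_comm]
  have c3 : x₀ ⬝ᵥ v = v ⬝ᵥ x₀ := dotProduct_comm _ _
  have hsplit : v ⬝ᵥ (A - B) *ᵥ v = v ⬝ᵥ (A - P) *ᵥ v - v ⬝ᵥ (B - P) *ᵥ v := by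
    simp only [sub_mulVec, dotProduct_sub]; ring
  generalize A - B = D at *
  simp only [sub_mulVec (1 : Matrix ι ι ℝ), one_mulVec, dotProduct_sub, smul_mulVec,
    dotProduct_smul, smul_eq_mul] at h0
  simp only [mulVec_add, dotProduct_add, add_dotProduct, c1, c2, c3] at hbound ⊢
  have := mul_nonneg hl0.le hBPnonneg
  rw [hsplit]
  linarith

end Projections

section Gaussian

variable {ι : Type*} [Fintype ι]

lemma pi_gaussianReal_eq_withDensity :
    (Measure.pi fun _ : ι => gaussianReal 0 1) =
      (volume : Measure (ι → ℝ)).withDensity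
        fun x => ENNReal.ofReal (∏ i, gaussianPDFReal 0 1 (x i)) := by
  refine Measure.pi_eq fun s hs => ?_
  have hsm : MeasurableSet (Set.univ.pi s) := MeasurableSet.univ_pi hs
  have hind : ∀ x : ι → ℝ, (Set.univ.pi s).indicator
      (fun x => ENNReal.ofReal (∏ i, gaussianPDFReal 0 1 (x i))) x =
      ENNReal.ofReal (∏ i, (s i).indicator (gaussianPDFReal 0 1) (x i)) := by
    intro x
    by_cases hx : x ∈ Set.univ.pi s
    · rw [Set.indicator_of_mem hx]
      congr 1
      exact Finset.prod_congr rfl fun i _ =>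
        (Set.indicator_of_mem (hx i (Set.mem_univ i)) _).symm
    · rw [Set.indicator_of_notMem hx]
      simp only [Set.mem_univ_pi, not_forall] at hx
      obtain ⟨i, hi⟩ := hx
      rw [Finset.prod_eq_zero (Finset.mem_univ i) (Set.indicator_of_notMem hi _),
        ENNReal.ofReal_zero]
  have h_integrable : ∀ i, Integrable ((s i).indicator (gaussianPDFReal 0 1)) := fun i =>
    (integrable_gaussianPDFReal 0 1).indicator (hs i)
  have hnn : ∀ i y, 0 ≤ (s i).indicator (gaussianPDFReal 0 1) y := fun i y =>
    Set.indicator_nonneg (fun z _ => gaussianPDFReal_nonneg 0 1 z) y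
  rw [withDensity_apply _ hsm, ← lintegral_indicator hsm]
  simp_rw [hind]
  have hprod : Integrable fun x : ι → ℝ => ∏ i, (s i).indicator (gaussianPDFReal 0 1) (x i) :=
    Integrable.fintype_prod_dep h_integrable
  rw [← ofReal_integral_eq_lintegral_ofReal hprod
    (ae_of_all _ fun x => Finset.prod_nonneg fun i _ => hnn i _),
    integral_fintype_prod_volume_eq_prod (fun i => (s i).indicator (gaussianPDFReal 0 1)),
    ENNReal.ofReal_prod_of_nonneg fun i _ => integral_nonneg (hnn i)]
  refine Finset.prod_congr rfl fun i _ => ?_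
  rw [integral_indicator (hs i), gaussianReal_apply_eq_integral 0 one_ne_zero]

lemma integral_pi_gaussianReal (f : (ι → ℝ) → ℝ) :
    ∫ x, f x ∂(Measure.pi fun _ : ι => gaussianReal 0 1) =
      ∫ x, (∏ i, gaussianPDFReal 0 1 (x i)) * f x := by
  rw [pi_gaussianReal_eq_withDensity, integral_withDensity_eq_integral_toReal_smul₀]
  · refine integral_congr_ae (ae_of_all _ fun x => ?_)
    simp only [smul_eq_mul]
    rw [ENNReal.toReal_ofReal (Finset.prod_nonneg fun i _ => gaussianPDFReal_nonneg 0 1 _)]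
  · exact (ENNReal.measurable_ofReal.comp (Finset.measurable_prod _ fun i _ =>
      (measurable_gaussianPDFReal 0 1).comp (measurable_pi_apply i))).aemeasurable
  · exact ae_of_all _ fun x => ENNReal.ofReal_lt_top

lemma prod_gaussianPDFReal (x : ι → ℝ) :
    ∏ i, gaussianPDFReal 0 1 (x i) =
      (√(2 * π))⁻¹ ^ Fintype.card ι * Real.exp (-(x ⬝ᵥ x) / 2) := by
  simp only [gaussianPDFReal, NNReal.coe_one, mul_one, sub_zero, Finset.prod_mul_distrib,
    Finset.prod_const, Finset.card_univ, ← Real.exp_sum, dotProduct]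
  congr 2
  rw [← Finset.sum_neg_distrib, Finset.sum_div]
  exact Finset.sum_congr rfl fun i _ => by ring

variable [DecidableEq ι]

lemma integrable_and_integral_gaussian_affine {R : Matrix ι ι ℝ} (hR : R.det ≠ 0) (x₀ : ι → ℝ) :
    Integrable (fun x : ι → ℝ => ∏ i, gaussianPDFReal 0 1 ((R *ᵥ (x - x₀)) i)) ∧
      ∫ x : ι → ℝ, ∏ i, gaussianPDFReal 0 1 ((R *ᵥ (x - x₀)) i) = |R.det|⁻¹ := by
  have hφ : Integrable (fun x : ι → ℝ => ∏ i, gaussianPDFReal 0 1 (x i)) :=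
    Integrable.fintype_prod_dep fun _ => integrable_gaussianPDFReal 0 1
  have hφ1 : ∫ x : ι → ℝ, ∏ i, gaussianPDFReal 0 1 (x i) = 1 := by
    rw [integral_fintype_prod_volume_eq_prod (fun _ => gaussianPDFReal 0 1)]
    simp [integral_gaussianPDFReal_eq_one]
  have hmap := Real.map_matrix_volume_pi_eq_smul_volume_pi hR
  have hmeas : Measurable (toLin' R) :=
    (LinearMap.continuous_of_finiteDimensional _).measurable
  have h_integrable : Integrable (fun x : ι → ℝ => ∏ i, gaussianPDFReal 0 1 (x i))
      (Measure.map (toLin' R) volume) := by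
    rw [hmap]; exact hφ.smul_measure ENNReal.ofReal_ne_top
  constructor
  · exact (h_integrable.comp_measurable hmeas).comp_sub_right x₀
  · rw [integral_sub_right_eq_self (fun x => ∏ i, gaussianPDFReal 0 1 ((R *ᵥ x) i)) x₀]
    have h := integral_map hmeas.aemeasurable h_integrable.aestronglyMeasurable
    rw [hmap, integral_smul_measure, hφ1] at h
    simp only [toLin'_apply] at h
    rw [← h, smul_eq_mul, mul_one, ENNReal.toReal_ofReal (abs_nonneg _), abs_inv]

end Gaussian

section ProjMat

variable {n p : ℕ} {X : Matrix (Fin n) (Fin p) ℝ} {S T : Finset (Fin p)}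

lemma isUnit_gram_colsSub
    (hLI : LinearIndependent ℝ (fun j : {j // j ∈ S} => fun i => X i j.1)) :
    IsUnit ((colsSub X S)ᵀ * colsSub X S).det := by
  have hinj : Function.Injective (colsSub X S).mulVec :=
    mulVec_injective_iff.mpr hLI
  have hpd := PosDef.conjTranspose_mul_self (colsSub X S) hinj
  rw [conjTranspose_eq_transpose_of_trivial] at hpd
  exact hpd.isUnit.map detMonoidHom

lemma transpose_projMat : (projMat X S)ᵀ = projMat X S := by
  simp [projMat, transpose_mul, transpose_nonsing_inv, Matrix.mul_assoc]

variable (hLI : LinearIndependent ℝ (fun j : {j // j ∈ S} => fun i => X i j.1))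
include hLI

lemma projMat_mul_colsSub_self : projMat X S * colsSub X S = colsSub X S := by
  rw [projMat, Matrix.mul_assoc, Matrix.mul_assoc, nonsing_inv_mul _ (isUnit_gram_colsSub hLI),
    Matrix.mul_one]

lemma projMat_mul_colsSub (hTS : T ⊆ S) : projMat X S * colsSub X T = colsSub X T := by
  ext i j
  exact congrFun (congrFun (projMat_mul_colsSub_self hLI) i) ⟨j.1, hTS j.2⟩

lemma projMat_mul_projMat (hTS : T ⊆ S) : projMat X S * projMat X T = projMat X T := by
  rw [projMat.eq_def X T, ← Matrix.mul_assoc, ← Matrix.mul_assoc, projMat_mul_colsSub hLI hTS]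

lemma projMat_mulVec_mulVec {b : Fin p → ℝ} (hb : ∀ j, j ∉ S → b j = 0) :
    projMat X S *ᵥ (X *ᵥ b) = X *ᵥ b := by
  have h : X *ᵥ b = colsSub X S *ᵥ fun j => b j.1 := by
    ext i
    simp only [mulVec, dotProduct, colsSub, of_apply]
    rw [Finset.sum_coe_sort S (fun j => X i j * b j)]
    exact (Finset.sum_subset (Finset.subset_univ S) fun j _ hj => by rw [hb j hj, mul_zero]).symm
  rw [h, mulVec_mulVec, projMat_mul_colsSub_self hLI]

lemma det_one_sub_smul_projMat (c : ℝ) : (1 - c • projMat X S).det = (1 - c) ^ S.card := by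
  have h : c • projMat X S =
      colsSub X S * (c • (((colsSub X S)ᵀ * colsSub X S)⁻¹ * (colsSub X S)ᵀ)) := by
    rw [projMat, Matrix.mul_smul, Matrix.mul_assoc]
  rw [h, det_one_sub_mul_comm, Matrix.smul_mul, Matrix.mul_assoc,
    nonsing_inv_mul _ (isUnit_gram_colsSub hLI), ← one_smul ℝ (1 : Matrix {j // j ∈ S} _ ℝ),
    smul_smul, mul_one, ← sub_smul, det_smul, det_one, mul_one, Fintype.card_coe]

lemma det_one_sub_smul_projMat_sub (hTS : T ⊆ S)
    (hLT : LinearIndependent ℝ (fun j : {j // j ∈ T} => fun i => X i j.1)) {c : ℝ}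
    (hc : 1 - c ≠ 0) :
    (1 - c • (projMat X S - projMat X T)).det = (1 - c) ^ (S.card - T.card) := by
  have hmul : (1 - c • (projMat X S - projMat X T)) * (1 - c • projMat X T) =
      1 - c • projMat X S := by
    have h1 := projMat_mul_projMat hLI hTS
    have h2 := projMat_mul_projMat hLT subset_rfl
    simp only [sub_mul, mul_sub, Matrix.one_mul, Matrix.mul_one, Matrix.smul_mul,
      Matrix.mul_smul, h1, h2, smul_sub]
    abel
  have hdet := congrArg det hmul
  rw [det_mul, det_one_sub_smul_projMat hLT, det_one_sub_smul_projMat hLI] at hdet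
  rw [pow_sub₀ _ hc (Finset.card_le_card hTS), ← hdet, mul_assoc,
    mul_inv_cancel₀ (pow_ne_zero _ hc), mul_one]

end ProjMat

/-- Moment generating function bound for the difference of projected quadratic forms:
if `y = Xβ* + σ₀ε` with `ε ~ N_n(0, I_n)` and `β*` supported on `S*`, then for `0 < l < 1`,
`E[exp{(l/(2σ₀²)) yᵀ(P_S − P_{S*})y}]
  ≤ (1−l)^{−(|S|−|S∩S*|)/2} exp{−(l(1−l)/(2σ₀²))‖(I−P_S)Xβ*‖²}`. -/
theorem mgf_bound_projected_quadratic_forms (n p : ℕ) (X : Matrix (Fin n) (Fin p) ℝ)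
    (S Sstar : Finset (Fin p))
    (hLI : LinearIndependent ℝ (fun j : {j // j ∈ S ∪ Sstar} => fun i => X i j.1))
    (σ₀ : ℝ) (hσ₀ : 0 < σ₀) (βstar : Fin p → ℝ)
    (hsupp : ∀ j, j ∉ Sstar → βstar j = 0)
    (l : ℝ) (hl0 : 0 < l) (hl1 : l < 1) :
    (∫ ε : Fin n → ℝ,
        Real.exp ((l / (2 * σ₀ ^ 2)) *
          ((X.mulVec βstar + σ₀ • ε) ⬝ᵥ
            ((projMat X S - projMat X Sstar).mulVec (X.mulVec βstar + σ₀ • ε))))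
        ∂(Measure.pi fun _ => gaussianReal 0 1)) ≤
      (1 - l) ^ (-(((S.card : ℝ) - ((S ∩ Sstar).card : ℝ)) / 2)) *
        Real.exp (-(l * (1 - l) / (2 * σ₀ ^ 2)) *
          (∑ i, (((1 - projMat X S)).mulVec (X.mulVec βstar) i) ^ 2)) := by
  have hsub : ∀ {U : Finset (Fin p)}, U ⊆ S ∪ Sstar →
      LinearIndependent ℝ (fun j : {j // j ∈ U} => fun i => X i j.1) := by
    intro U hU
    have hinj : Function.Injective
        (fun j : {j // j ∈ U} => (⟨j.1, hU j.2⟩ : {j // j ∈ S ∪ Sstar})) :=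
      fun a b hab => Subtype.ext (Subtype.mk.inj hab)
    exact hLI.comp _ hinj
  have hLS := hsub (U := S) Finset.subset_union_left
  have hLB := hsub (U := Sstar) Finset.subset_union_right
  have hTS : S ∩ Sstar ⊆ S := Finset.inter_subset_left
  have hLT := hsub (U := S ∩ Sstar) (hTS.trans Finset.subset_union_left)
  have hμ := projMat_mulVec_mulVec hLB hsupp
  obtain ⟨x₀, hx₀⟩ := exists_quadratic_sub_le (m := σ₀⁻¹ • X *ᵥ βstar)
    transpose_projMat (projMat_mul_projMat hLS subset_rfl)
    transpose_projMat (projMat_mul_projMat hLB subset_rfl)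
    transpose_projMat (projMat_mul_projMat hLT subset_rfl)
    (projMat_mul_projMat hLS hTS) (projMat_mul_projMat hLB Finset.inter_subset_right)
    (by rw [mulVec_smul, hμ]) hl0 hl1
  set c : ℝ := 1 - √(1 - l) with hc
  have hspos : 0 < √(1 - l) := Real.sqrt_pos.mpr (by linarith)
  have hc1 : 1 - c = √(1 - l) := by rw [hc]; ring
  have hdet := det_one_sub_smul_projMat_sub hLS hTS hLT (c := c) (by rw [hc1]; exact hspos.ne')
  set R := 1 - c • (projMat X S - projMat X (S ∩ Sstar))
  rw [hc1] at hdet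
  have hdetpos : 0 < R.det := hdet ▸ pow_pos hspos _
  obtain ⟨h_integrable, hval⟩ := integrable_and_integral_gaussian_affine hdetpos.ne' x₀
  set C := Real.exp (-(l * (1 - l) / (2 * σ₀ ^ 2)) *
    (∑ i, (((1 - projMat X S)).mulVec (X.mulVec βstar) i) ^ 2)) with hC
  have hfactor : (1 - l) ^ (-(((S.card : ℝ) - ((S ∩ Sstar).card : ℝ)) / 2)) = |R.det|⁻¹ := by
    rw [abs_of_pos hdetpos, hdet, ← Real.rpow_natCast, Nat.cast_sub (Finset.card_le_card hTS),
      Real.sqrt_eq_rpow, ← Real.rpow_mul (by linarith), ← Real.rpow_neg (by linarith)]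
    congr 1
    ring
  rw [hfactor, integral_pi_gaussianReal, ← hval, ← integral_mul_const]
  refine integral_mono_of_nonneg (ae_of_all _ fun x => ?_) (h_integrable.mul_const C)
    (ae_of_all _ fun x => ?_)
  · exact mul_nonneg (Finset.prod_nonneg fun i _ => gaussianPDFReal_nonneg 0 1 _)
      (Real.exp_pos _).le
  · have hscale : X *ᵥ βstar + σ₀ • x = σ₀ • (σ₀⁻¹ • X *ᵥ βstar + x) := by
      rw [smul_add, smul_smul, mul_inv_cancel₀ hσ₀.ne', one_smul]
    have hnorm : (∑ i, (((1 - projMat X S)).mulVec (X.mulVec βstar) i) ^ 2) =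
        σ₀ ^ 2 * ((1 - projMat X S) *ᵥ (σ₀⁻¹ • X *ᵥ βstar) ⬝ᵥ
          (1 - projMat X S) *ᵥ (σ₀⁻¹ • X *ᵥ βstar)) := by
      simp only [mulVec_smul, smul_dotProduct, dotProduct_smul, smul_eq_mul]
      field_simp
      simp only [dotProduct, sq]
    have hx := hx₀ x
    beta_reduce
    rw [hC, hnorm, hscale, prod_gaussianPDFReal, prod_gaussianPDFReal, mul_assoc, mul_assoc,
      ← Real.exp_add, ← Real.exp_add]
    refine mul_le_mul_of_nonneg_left (Real.exp_le_exp.mpr ?_) (by positivity)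
    rw [mulVec_smul, smul_dotProduct, dotProduct_smul, smul_eq_mul, smul_eq_mul]
    generalize (σ₀⁻¹ • X *ᵥ βstar + x) ⬝ᵥ
      (projMat X S - projMat X Sstar) *ᵥ (σ₀⁻¹ • X *ᵥ βstar + x) = q at *
    generalize (1 - projMat X S) *ᵥ (σ₀⁻¹ • X *ᵥ βstar) ⬝ᵥ
          (1 - projMat X S) *ᵥ (σ₀⁻¹ • X *ᵥ βstar) = k at *
    have e1 : l / (2 * σ₀ ^ 2) * (σ₀ * (σ₀ * q)) = l * q / 2 := by field_simp
    have e2 : -(l * (1 - l) / (2 * σ₀ ^ 2)) * (σ₀ ^ 2 * k) = -(l * (1 - l)) * k / 2 := by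
      field_simp
    rw [e1, e2]
    linarith
end
end

section
/- Posterior dimension concentration (Theorem 1): assume s* ≤ R and conditions (A1)–(A3). Then there exist constants C > 1 and G > 0 such that, with Δ_n = C s* and B_n(Δ_n) = {β ∈ ℝ^p : |S_β| ≥ Δ_n}, for all sufficiently large n, E_{β*}[Π^n(B_n(Δ_n))] ≤ exp(−G s* log(p/s*)), uniformly over all true coefficient vectors β* satisfying the assumptions; in particular E_{β*}[Π^n(B_n(Δ_n))] → 0 as n → ∞. -/
open MeasureTheory ProbabilityTheory Real Filter Matrix
open scoped ENNReal NNReal BigOperators Classical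

noncomputable section

namespace EmpiricalBayes

/-- Submatrix of columns of `X` indexed by `S`. -/
def XS {n p : ℕ} (X : Matrix (Fin n) (Fin p) ℝ) (S : Finset (Fin p)) :
    Matrix (Fin n) {j // j ∈ S} ℝ := Matrix.of fun i j => X i j.1

/-- The Gram matrix `X_Sᵀ X_S`. -/
def gram {n p : ℕ} (X : Matrix (Fin n) (Fin p) ℝ) (S : Finset (Fin p)) :
    Matrix {j // j ∈ S} {j // j ∈ S} ℝ := (XS X S)ᵀ * XS X S

/-- Least squares estimator `β̂_S = (X_SᵀX_S)⁻¹X_Sᵀ y`. -/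
def betaHat {n p : ℕ} (X : Matrix (Fin n) (Fin p) ℝ) (S : Finset (Fin p))
    (y : Fin n → ℝ) : {j // j ∈ S} → ℝ := ((gram X S)⁻¹ * (XS X S)ᵀ).mulVec y

/-- Fitted values `ŷ_S = X_S β̂_S`. -/
def yHat {n p : ℕ} (X : Matrix (Fin n) (Fin p) ℝ) (S : Finset (Fin p))
    (y : Fin n → ℝ) : Fin n → ℝ := (XS X S).mulVec (betaHat X S y)

/-- Residual sum of squares `‖y - ŷ_S‖²`. -/
def rss {n p : ℕ} (X : Matrix (Fin n) (Fin p) ℝ) (S : Finset (Fin p))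
    (y : Fin n → ℝ) : ℝ := ∑ i, (y i - yHat X S y i) ^ 2

/-- Quadratic form `(β_S - β̂_S)ᵀ X_SᵀX_S (β_S - β̂_S)`. -/
def quadForm {n p : ℕ} (X : Matrix (Fin n) (Fin p) ℝ) (S : Finset (Fin p))
    (y : Fin n → ℝ) (b : {j // j ∈ S} → ℝ) : ℝ :=
  (b - betaHat X S y) ⬝ᵥ ((gram X S).mulVec (b - betaHat X S y))

/-- Prior weight `π(S) = binom(p,|S|)⁻¹ (c p^a)^{-|S|}` for `|S| ≤ R`, `0` otherwise
(the normalizing constant of `f_n` is irrelevant, as it cancels in the posterior). -/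
def priorWt (p R : ℕ) (a c : ℝ) (S : Finset (Fin p)) : ℝ :=
  if S.card ≤ R then ((p.choose S.card : ℝ))⁻¹ * (c * (p : ℝ) ^ a) ^ (-(S.card : ℝ)) else 0

/-- Exponent `nα/2 + s/2 + a₀` of the multivariate t kernel. -/
def tExp (n : ℕ) (α a₀ : ℝ) (s : ℕ) : ℝ := n * α / 2 + s / 2 + a₀

/-- The (unnormalized) density `D_S^n(β_S)` of the empirical Bayes posterior on model `S`. -/
def Ddens {n p : ℕ} (R : ℕ) (X : Matrix (Fin n) (Fin p) ℝ) (a₀ b₀ a c γ α : ℝ)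
    (y : Fin n → ℝ) (S : Finset (Fin p)) (b : {j // j ∈ S} → ℝ) : ℝ :=
  priorWt p R a c S * (2 * π) ^ (-(S.card : ℝ) / 2) * Real.Gamma (tExp n α a₀ S.card) *
    Real.sqrt ((γ • gram X S).det) *
    (b₀ + (α + γ) / 2 * quadForm X S y b + α / 2 * rss X S y) ^ (-(tExp n α a₀ S.card))

/-- Augment `β_S` with zeros outside `S`. -/
def augment {p : ℕ} (S : Finset (Fin p)) (b : {j // j ∈ S} → ℝ) : Fin p → ℝ :=
  fun j => if h : j ∈ S then b ⟨j, h⟩ else 0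

/-- The contribution `∫ D_S^n(dβ_S) δ_0(dβ_{S^c})` of model `S` to the (unnormalized)
empirical Bayes posterior. -/
def modelMeasure {n p : ℕ} (R : ℕ) (X : Matrix (Fin n) (Fin p) ℝ) (a₀ b₀ a c γ α : ℝ)
    (y : Fin n → ℝ) (S : Finset (Fin p)) : Measure (Fin p → ℝ) :=
  Measure.map (augment S)
    ((volume : Measure ({j // j ∈ S} → ℝ)).withDensity
      fun b => ENNReal.ofReal (Ddens R X a₀ b₀ a c γ α y S b))

/-- The unnormalized empirical Bayes posterior `Σ_S ∫ D_S^n(dβ_S) δ_0(dβ_{S^c})`. -/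
def postUnnorm {n p : ℕ} (R : ℕ) (X : Matrix (Fin n) (Fin p) ℝ) (a₀ b₀ a c γ α : ℝ)
    (y : Fin n → ℝ) : Measure (Fin p → ℝ) :=
  ∑ S : Finset (Fin p), modelMeasure R X a₀ b₀ a c γ α y S

/-- The empirical Bayes posterior `Π^n` on `ℝ^p`. -/
def post {n p : ℕ} (R : ℕ) (X : Matrix (Fin n) (Fin p) ℝ) (a₀ b₀ a c γ α : ℝ)
    (y : Fin n → ℝ) : Measure (Fin p → ℝ) :=
  (postUnnorm R X a₀ b₀ a c γ α y Set.univ)⁻¹ • postUnnorm R X a₀ b₀ a c γ α y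

/-- The Gaussian measure `N_n(m, v I_n)` on `ℝⁿ`. -/
def gaussVec (n : ℕ) (m : Fin n → ℝ) (v : ℝ) : Measure (Fin n → ℝ) :=
  Measure.pi fun i => gaussianReal (m i) v.toNNReal

/-- The sampling distribution of the data, `y ~ N_n(Xβ*, σ₀² I_n)`. -/
def dataDist {n p : ℕ} (X : Matrix (Fin n) (Fin p) ℝ) (βstar : Fin p → ℝ)
    (σ0sq : ℝ) : Measure (Fin n → ℝ) := gaussVec n (X.mulVec βstar) σ0sq

/-- Unnormalized marginal posterior model weight
`π(S)(γ/(α+γ))^{|S|/2}(b₀ + α‖y-ŷ_S‖²/2)^{-(a₀+αn/2)}`. -/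
def modelWt {n p : ℕ} (R : ℕ) (X : Matrix (Fin n) (Fin p) ℝ) (a₀ b₀ a c γ α : ℝ)
    (y : Fin n → ℝ) (S : Finset (Fin p)) : ℝ :=
  priorWt p R a c S * (γ / (α + γ)) ^ ((S.card : ℝ) / 2) *
    (b₀ + α / 2 * rss X S y) ^ (-(a₀ + α * n / 2))

/-- The marginal posterior probability `π^n(S)` of model `S`. -/
def postModel {n p : ℕ} (R : ℕ) (X : Matrix (Fin n) (Fin p) ℝ) (a₀ b₀ a c γ α : ℝ)
    (y : Fin n → ℝ) (S : Finset (Fin p)) : ℝ :=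
  modelWt R X a₀ b₀ a c γ α y S / ∑ S' : Finset (Fin p), modelWt R X a₀ b₀ a c γ α y S'

/-- The compatibility number `κ(s) = inf{‖Xβ‖₂/‖β‖₂ : 0 < |S_β| ≤ s}`. -/
def kappa {n p : ℕ} (X : Matrix (Fin n) (Fin p) ℝ) (s : ℝ) : ℝ :=
  sInf ((fun β : Fin p → ℝ =>
      Real.sqrt (∑ i, (X.mulVec β i) ^ 2) / Real.sqrt (∑ j, β j ^ 2)) ''
    {β | 0 < (Function.support β).ncard ∧ ((Function.support β).ncard : ℝ) ≤ s})

/-- Orthogonal projection `P_S = X_S(X_SᵀX_S)⁻¹X_Sᵀ` onto the column span of `X_S`. -/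
def projMat {n p : ℕ} (X : Matrix (Fin n) (Fin p) ℝ) (S : Finset (Fin p)) :
    Matrix (Fin n) (Fin n) ℝ := XS X S * (gram X S)⁻¹ * (XS X S)ᵀ

/-- Support of a coefficient vector as a `Finset`. -/
def suppFinset {p : ℕ} (β : Fin p → ℝ) : Finset (Fin p) :=
  Finset.univ.filter fun j => β j ≠ 0


lemma sqrt_pow_eq_rpow {x : ℝ} (hx : 0 ≤ x) (k : ℕ) : √(x ^ k) = x ^ ((k : ℝ) / 2) := by
  rw [Real.sqrt_eq_rpow, ← Real.rpow_natCast, ← Real.rpow_mul hx]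
  congr 1
  ring

lemma sqrt_pow_eq_pow_sqrt {x : ℝ} (hx : 0 ≤ x) (k : ℕ) : √(x ^ k) = √x ^ k := by
  rw [Real.sqrt_eq_iff_mul_self_eq (by positivity) (by positivity), ← mul_pow,
    Real.mul_self_sqrt hx]

section GaussianIntegrals

variable {ι : Type*} [Fintype ι]

lemma lintegral_exp_neg_dotProduct_self :
    ∫⁻ w : ι → ℝ, ENNReal.ofReal (Real.exp (-(w ⬝ᵥ w))) =
      ENNReal.ofReal (√π ^ Fintype.card ι) := by
  have h1 : ∀ w : ι → ℝ, Real.exp (-(w ⬝ᵥ w)) = ∏ i, Real.exp (-1 * w i ^ 2) := by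
    intro w
    rw [← Real.exp_sum, dotProduct, ← Finset.sum_neg_distrib]
    congr 1
    exact Finset.sum_congr rfl fun i _ => by ring
  simp_rw [h1]
  rw [← ofReal_integral_eq_lintegral_ofReal]
  · rw [volume_pi, integral_fintype_prod_eq_prod (fun _ : ι => fun x : ℝ => Real.exp (-1 * x ^ 2))]
    simp_rw [integral_gaussian]
    simp
  · exact Integrable.fintype_prod (f := fun _ : ι => fun x : ℝ => Real.exp (-1 * x ^ 2))
      fun _ => integrable_exp_neg_mul_sq one_pos
  · exact ae_of_all _ fun w => Finset.prod_nonneg fun i _ => (Real.exp_pos _).le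

lemma exists_transpose_mul_self {M : Matrix ι ι ℝ} (hM : M.PosDef) :
    ∃ B : Matrix ι ι ℝ, M = Bᵀ * B := by
  open scoped MatrixOrder Matrix.Norms.L2Operator in
  obtain ⟨B, hB⟩ := CStarAlgebra.nonneg_iff_eq_star_mul_self.mp hM.posSemidef.nonneg
  exact ⟨B, by simpa [star_eq_conjTranspose] using hB⟩

/-- The Gaussian integral of a positive definite quadratic form. -/
lemma lintegral_exp_neg_quadratic [DecidableEq ι] {M : Matrix ι ι ℝ} (hM : M.PosDef) :
    ∫⁻ w : ι → ℝ, ENNReal.ofReal (Real.exp (-(w ⬝ᵥ M *ᵥ w))) =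
      ENNReal.ofReal (√π ^ Fintype.card ι / √M.det) := by
  obtain ⟨B, rfl⟩ := exists_transpose_mul_self hM
  have hdet : (Bᵀ * B).det = B.det ^ 2 := by rw [det_mul, det_transpose, sq]
  have hB : B.det ≠ 0 := by
    intro h
    have := hM.det_pos
    rw [hdet, h] at this
    simp at this
  have hq : ∀ w : ι → ℝ, w ⬝ᵥ (Bᵀ * B) *ᵥ w = (toLin' B w) ⬝ᵥ (toLin' B w) := by
    intro w
    rw [toLin'_apply, ← mulVec_mulVec, dotProduct_mulVec, vecMul_transpose]
  simp_rw [hq]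
  have hm : Measurable fun w : ι → ℝ => ENNReal.ofReal (Real.exp (-(w ⬝ᵥ w))) := by
    unfold dotProduct; fun_prop
  have hlin : Measurable (toLin' B) :=
    (LinearMap.continuous_of_finiteDimensional (toLin' B)).measurable
  rw [← lintegral_map hm hlin, Real.map_matrix_volume_pi_eq_smul_volume_pi hB,
    lintegral_smul_measure, lintegral_exp_neg_dotProduct_self, smul_eq_mul,
    ← ENNReal.ofReal_mul (abs_nonneg _), hdet, Real.sqrt_sq_eq_abs, abs_inv]
  congr 1
  rw [inv_mul_eq_div]

lemma pi_withDensity_ofReal (g : ι → ℝ → ℝ) (hg : ∀ i x, 0 ≤ g i x)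
    (hgi : ∀ i, Integrable (g i)) :
    Measure.pi (fun i => volume.withDensity fun x => ENNReal.ofReal (g i x)) =
      (volume : Measure (ι → ℝ)).withDensity fun x => ENNReal.ofReal (∏ i, g i (x i)) := by
  have : ∀ i, IsFiniteMeasure (volume.withDensity fun x => ENNReal.ofReal (g i x)) :=
    fun i => isFiniteMeasure_withDensity_ofReal (hgi i).2
  refine Measure.pi_eq fun s hs => ?_
  rw [withDensity_apply _ (MeasurableSet.univ_pi hs), volume_pi, Measure.restrict_pi_pi,
    ← ofReal_integral_eq_lintegral_ofReal]
  · rw [integral_fintype_prod_eq_prod, ENNReal.ofReal_prod_of_nonneg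
      fun i _ => integral_nonneg (hg i)]
    refine Finset.prod_congr rfl fun i _ => ?_
    rw [withDensity_apply _ (hs i), ofReal_integral_eq_lintegral_ofReal (hgi i).restrict
      (ae_of_all _ (hg i))]
  · exact Integrable.fintype_prod fun i => (hgi i).restrict
  · exact ae_of_all _ fun w => Finset.prod_nonneg fun i _ => hg i _

end GaussianIntegrals

lemma lintegral_gaussVec_exp_quadratic {n : ℕ} (m : Fin n → ℝ) {v : ℝ} (hv : 0 < v)
    {A : Matrix (Fin n) (Fin n) ℝ} (hA : (1 + A).PosDef) :
    ∫⁻ y, ENNReal.ofReal (Real.exp (-((y - m) ⬝ᵥ A *ᵥ (y - m)) / (2 * v))) ∂(gaussVec n m v) =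
      ENNReal.ofReal (√(1 + A).det)⁻¹ := by
  have hv' : v.toNNReal ≠ 0 := by simpa using hv
  have hvc : (v.toNNReal : ℝ) = v := Real.coe_toNNReal v hv.le
  have hg : gaussVec n m v = (volume : Measure (Fin n → ℝ)).withDensity
      fun x => ENNReal.ofReal (∏ i, gaussianPDFReal (m i) v.toNNReal (x i)) := by
    rw [gaussVec, ← pi_withDensity_ofReal (fun i => gaussianPDFReal (m i) v.toNNReal)
      (fun i => gaussianPDFReal_nonneg _ _) (fun i => integrable_gaussianPDFReal _ _)]
    congr 1
    funext i
    rw [gaussianReal_of_var_ne_zero _ hv']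
    rfl
  have hpd : ((2 * v)⁻¹ • (1 + A)).PosDef := hA.smul (by positivity)
  have hdens : ∀ x : Fin n → ℝ, ∏ i, gaussianPDFReal (m i) v.toNNReal (x i) =
      (√(2 * π * v))⁻¹ ^ n * Real.exp (-((x - m) ⬝ᵥ (x - m)) / (2 * v)) := by
    intro x
    simp only [gaussianPDFReal, hvc, Finset.prod_mul_distrib, Finset.prod_const,
      Finset.card_univ, Fintype.card_fin, ← Real.exp_sum]
    congr 2
    rw [dotProduct, ← Finset.sum_div, ← Finset.sum_neg_distrib]
    congr 1
    exact Finset.sum_congr rfl fun i _ => by simp [sq]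
  have hmeas : ∀ B : Matrix (Fin n) (Fin n) ℝ,
      Measurable fun x : Fin n → ℝ => (x - m) ⬝ᵥ B *ᵥ (x - m) := by
    intro B
    unfold dotProduct mulVec dotProduct
    fun_prop
  have hmeas' : Measurable fun x : Fin n → ℝ => (x - m) ⬝ᵥ (x - m) := by
    simpa using hmeas 1
  rw [hg, lintegral_withDensity_eq_lintegral_mul₀ ?_ ?_]
  rotate_left
  · simp_rw [hdens]
    fun_prop
  · have := hmeas A
    fun_prop
  have hcomb : ∀ x : Fin n → ℝ,
      ENNReal.ofReal (∏ i, gaussianPDFReal (m i) v.toNNReal (x i)) *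
        ENNReal.ofReal (Real.exp (-((x - m) ⬝ᵥ A *ᵥ (x - m)) / (2 * v))) =
      ENNReal.ofReal ((√(2 * π * v))⁻¹ ^ n) * ENNReal.ofReal
        (Real.exp (-((x - m) ⬝ᵥ ((2 * v)⁻¹ • (1 + A)) *ᵥ (x - m)))) := by
    intro x
    rw [hdens, ← ENNReal.ofReal_mul (by positivity), ← ENNReal.ofReal_mul (by positivity),
      mul_assoc, ← Real.exp_add]
    congr 3
    rw [smul_mulVec, add_mulVec, one_mulVec, dotProduct_smul, dotProduct_add, smul_eq_mul]
    field_simp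
    ring
  simp only [Pi.mul_apply]
  simp_rw [hcomb]
  rw [lintegral_const_mul' _ _ ENNReal.ofReal_ne_top,
    lintegral_sub_right_eq_self
      (fun w => ENNReal.ofReal (Real.exp (-(w ⬝ᵥ ((2 * v)⁻¹ • (1 + A)) *ᵥ w)))) m,
    lintegral_exp_neg_quadratic hpd, ← ENNReal.ofReal_mul (by positivity)]
  congr 1
  have hsq : √(2 * π * v) = √π / √(2 * v)⁻¹ := by
    rw [← Real.sqrt_div Real.pi_pos.le]
    congr 1
    field_simp
  have h2v : 0 < √(2 * v)⁻¹ := Real.sqrt_pos.2 (by positivity)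
  have hpi : 0 < √π := Real.sqrt_pos.2 Real.pi_pos
  rw [hsq, det_smul, Fintype.card_fin, Real.sqrt_mul (by positivity),
    sqrt_pow_eq_pow_sqrt (by positivity), inv_pow, div_pow]
  field_simp

section Projection

variable {n p : ℕ} (X : Matrix (Fin n) (Fin p) ℝ) (S : Finset (Fin p))

lemma gram_transpose : (gram X S)ᵀ = gram X S := by
  rw [gram, transpose_mul, transpose_transpose]

lemma projMat_transpose : (projMat X S)ᵀ = projMat X S := by
  rw [projMat, transpose_mul, transpose_mul, transpose_transpose, transpose_nonsing_inv,
    gram_transpose, Matrix.mul_assoc]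

lemma yHat_eq_projMat_mulVec (y : Fin n → ℝ) : yHat X S y = projMat X S *ᵥ y := by
  rw [yHat, betaHat, mulVec_mulVec, projMat, Matrix.mul_assoc]

lemma rss_nonneg (y : Fin n → ℝ) : 0 ≤ rss X S y := Finset.sum_nonneg fun _ _ => sq_nonneg _

variable {X S}

lemma projMat_mul_XS (h : IsUnit (gram X S).det) : projMat X S * XS X S = XS X S := by
  rw [projMat, Matrix.mul_assoc, Matrix.mul_assoc]
  change XS X S * ((gram X S)⁻¹ * gram X S) = _
  rw [nonsing_inv_mul _ h, Matrix.mul_one]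

lemma projMat_mul_self (h : IsUnit (gram X S).det) : projMat X S * projMat X S = projMat X S := by
  have h1 : projMat X S = XS X S * ((gram X S)⁻¹ * (XS X S)ᵀ) := Matrix.mul_assoc _ _ _
  calc projMat X S * projMat X S = projMat X S * XS X S * ((gram X S)⁻¹ * (XS X S)ᵀ) := by
        rw [Matrix.mul_assoc, ← h1]
    _ = projMat X S := by rw [projMat_mul_XS h, ← h1]

lemma dotProduct_projMat (h : IsUnit (gram X S).det) (y : Fin n → ℝ) :
    y ⬝ᵥ projMat X S *ᵥ y = projMat X S *ᵥ y ⬝ᵥ projMat X S *ᵥ y := by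
  conv_lhs => rw [← projMat_mul_self h, ← mulVec_mulVec, dotProduct_mulVec, ← mulVec_transpose,
    projMat_transpose]

lemma dotProduct_projMat_nonneg (h : IsUnit (gram X S).det) (y : Fin n → ℝ) :
    0 ≤ y ⬝ᵥ projMat X S *ᵥ y := by
  rw [dotProduct_projMat h]
  exact Finset.sum_nonneg fun _ _ => mul_self_nonneg _

lemma rss_eq_sub (h : IsUnit (gram X S).det) (y : Fin n → ℝ) :
    rss X S y = y ⬝ᵥ y - y ⬝ᵥ projMat X S *ᵥ y := by
  have h1 : rss X S y = (y - projMat X S *ᵥ y) ⬝ᵥ (y - projMat X S *ᵥ y) := by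
    rw [rss, yHat_eq_projMat_mulVec]
    exact Finset.sum_congr rfl fun _ _ => by simp [sq]
  rw [h1, sub_dotProduct, dotProduct_sub, dotProduct_sub, ← dotProduct_projMat h,
    dotProduct_comm (projMat X S *ᵥ y) y]
  ring

lemma dotProduct_projMat_le (h : IsUnit (gram X S).det) (y : Fin n → ℝ) :
    y ⬝ᵥ projMat X S *ᵥ y ≤ y ⬝ᵥ y := by
  have := rss_nonneg X S y
  rw [rss_eq_sub h] at this
  linarith

lemma rss_add_mulVec (h : IsUnit (gram X S).det) (e : Fin n → ℝ) (b : {j // j ∈ S} → ℝ) :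
    rss X S (e + XS X S *ᵥ b) = rss X S e := by
  have h1 : projMat X S *ᵥ (XS X S *ᵥ b) = XS X S *ᵥ b := by
    rw [mulVec_mulVec, projMat_mul_XS h]
  unfold rss
  simp only [yHat_eq_projMat_mulVec, mulVec_add, h1, Pi.add_apply, add_sub_add_right_eq_sub]

/-- Least squares minimises the residual sum of squares. -/
lemma rss_le (h : IsUnit (gram X S).det) (y : Fin n → ℝ) (b : {j // j ∈ S} → ℝ) :
    rss X S y ≤ (y - XS X S *ᵥ b) ⬝ᵥ (y - XS X S *ᵥ b) := by
  have h1 := rss_add_mulVec h (y - XS X S *ᵥ b) b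
  rw [sub_add_cancel] at h1
  rw [h1, rss_eq_sub h]
  linarith [dotProduct_projMat_nonneg h (y - XS X S *ᵥ b)]

lemma rss_le_rss (h : IsUnit (gram X S).det) {T : Finset (Fin p)} (y : Fin n → ℝ)
    (hTS : ∀ b, ∃ b', XS X S *ᵥ b' = XS X T *ᵥ b) : rss X S y ≤ rss X T y := by
  obtain ⟨b', hb'⟩ := hTS (betaHat X T y)
  have h1 := rss_le h y b'
  rw [hb'] at h1
  refine h1.trans_eq ?_
  exact Finset.sum_congr rfl fun _ _ => (sq _).symm

lemma det_smul_one_sub_smul_projMat (h : IsUnit (gram X S).det) {t u : ℝ} (ht : t ≠ 0) :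
    (t • (1 : Matrix (Fin n) (Fin n) ℝ) - u • projMat X S).det =
      t ^ n * (1 - u / t) ^ S.card := by
  have h1 : t • (1 : Matrix (Fin n) (Fin n) ℝ) - u • projMat X S =
      t • (1 - XS X S * ((u / t) • ((gram X S)⁻¹ * (XS X S)ᵀ))) := by
    rw [Matrix.mul_smul, ← Matrix.mul_assoc, ← projMat.eq_1, smul_sub, smul_smul,
      mul_div_cancel₀ _ ht]
  have h2 : (1 : Matrix {j // j ∈ S} {j // j ∈ S} ℝ) -
      ((u / t) • ((gram X S)⁻¹ * (XS X S)ᵀ)) * XS X S = (1 - u / t) • 1 := by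
    rw [Matrix.smul_mul, Matrix.mul_assoc]
    change 1 - (u / t) • ((gram X S)⁻¹ * gram X S) = _
    rw [nonsing_inv_mul _ h, sub_smul, one_smul]
  rw [h1, det_smul, det_one_sub_mul_comm, h2, det_smul]
  simp

lemma posDef_smul_one_sub_smul_projMat (h : IsUnit (gram X S).det) {t u : ℝ}
    (hu : 0 ≤ u) (hut : u < t) :
    (t • (1 : Matrix (Fin n) (Fin n) ℝ) - u • projMat X S).PosDef := by
  refine PosDef.of_dotProduct_mulVec_pos ?_ fun x hx => ?_
  · rw [IsHermitian, conjTranspose_eq_transpose_of_trivial, transpose_sub, transpose_smul,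
      transpose_smul, transpose_one, projMat_transpose]
  · rw [star_trivial, sub_mulVec, smul_mulVec, smul_mulVec, one_mulVec, dotProduct_sub,
      dotProduct_smul, dotProduct_smul, smul_eq_mul, smul_eq_mul]
    have h1 := dotProduct_projMat_le h x
    have h2 : 0 < x ⬝ᵥ x := by
      have := dotProduct_star_self_pos_iff.2 hx
      rwa [star_trivial] at this
    nlinarith

lemma gram_posDef (h : IsUnit (gram X S).det) : (gram X S).PosDef := by
  have h1 : (gram X S).PosSemidef := by
    have := posSemidef_conjTranspose_mul_self (XS X S)
    rwa [conjTranspose_eq_transpose_of_trivial] at this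
  exact h1.posDef_iff_det_ne_zero.2 h.ne_zero

/-- Exponential moments of the Gaussian quadratic form `k ‖ε‖² - u ‖P_S ε‖²`. -/
lemma lintegral_gaussVec_exp_projMat (h : IsUnit (gram X S).det) (m : Fin n → ℝ)
    {v k u : ℝ} (hv : 0 < v) (hu : 0 ≤ u) (hk : 0 ≤ k) (huk : u < 1 + k) :
    ∫⁻ y, ENNReal.ofReal (Real.exp (-(k * ((y - m) ⬝ᵥ (y - m)) -
        u * ((y - m) ⬝ᵥ projMat X S *ᵥ (y - m))) / (2 * v))) ∂(gaussVec n m v) =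
      ENNReal.ofReal (√((1 + k) ^ n * (1 - u / (1 + k)) ^ S.card))⁻¹ := by
  have h1 : (1 : Matrix (Fin n) (Fin n) ℝ) + (k • 1 - u • projMat X S) =
      (1 + k) • 1 - u • projMat X S := by
    rw [add_smul, one_smul, add_sub_assoc]
  have h2 := lintegral_gaussVec_exp_quadratic m hv (A := k • 1 - u • projMat X S)
    (by rw [h1]; exact posDef_smul_one_sub_smul_projMat h hu huk)
  rw [h1, det_smul_one_sub_smul_projMat h (by positivity)] at h2
  rw [← h2]
  refine lintegral_congr fun y => ?_
  have h3 : (y - m) ⬝ᵥ (k • (1 : Matrix (Fin n) (Fin n) ℝ) - u • projMat X S) *ᵥ (y - m) =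
      k * ((y - m) ⬝ᵥ (y - m)) - u * ((y - m) ⬝ᵥ projMat X S *ᵥ (y - m)) := by
    rw [sub_mulVec, smul_mulVec, smul_mulVec, one_mulVec,
      dotProduct_sub (y - m) (k • (y - m)), dotProduct_smul, dotProduct_smul, smul_eq_mul,
      smul_eq_mul]
  rw [h3]

end Projection

section ColumnSpan

variable {n p : ℕ} (X : Matrix (Fin n) (Fin p) ℝ)

lemma XS_mulVec_restrict {S : Finset (Fin p)} {b : Fin p → ℝ} (hb : ∀ j ∉ S, b j = 0) :
    XS X S *ᵥ (fun j => b j.1) = X *ᵥ b := by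
  funext i
  simp only [mulVec, dotProduct, XS, of_apply]
  rw [Finset.sum_coe_sort S fun j => X i j * b j]
  exact Finset.sum_subset (Finset.subset_univ S) fun j _ hj => by rw [hb j hj, mul_zero]

lemma mulVec_augment {S : Finset (Fin p)} (b : {j // j ∈ S} → ℝ) :
    X *ᵥ augment S b = XS X S *ᵥ b := by
  rw [← XS_mulVec_restrict X (S := S) (b := augment S b) fun j hj => by simp [augment, hj]]
  congr 1
  funext j
  simp [augment, j.2]

lemma exists_XS_mulVec_eq_of_subset {S T : Finset (Fin p)} (hST : S ⊆ T)
    (b : {j // j ∈ S} → ℝ) : ∃ b', XS X T *ᵥ b' = XS X S *ᵥ b :=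
  ⟨fun j => augment S b j.1, by
    rw [XS_mulVec_restrict, mulVec_augment]
    intro j hj
    have : j ∉ S := fun h => hj (hST h)
    simp [augment, this]⟩

lemma exists_XS_mulVec_eq_of_card_eq_rank {T : Finset (Fin p)} (hT : IsUnit (gram X T).det)
    (hcard : T.card = X.rank) (b : Fin p → ℝ) : ∃ b', XS X T *ᵥ b' = X *ᵥ b := by
  have hinj : Function.Injective (XS X T).mulVecLin := by
    intro u v huv
    have h1 : gram X T *ᵥ u = gram X T *ᵥ v := by
      rw [gram, ← mulVec_mulVec, ← mulVec_mulVec]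
      exact congrArg _ huv
    have h2 := congrArg (fun w => (gram X T)⁻¹ *ᵥ w) h1
    simpa [mulVec_mulVec, nonsing_inv_mul _ hT] using h2
  have hle : LinearMap.range (XS X T).mulVecLin ≤ LinearMap.range X.mulVecLin := by
    rintro _ ⟨b, rfl⟩
    exact ⟨augment T b, by simp [mulVec_augment]⟩
  have heq := Submodule.eq_of_le_of_finrank_eq hle (by
    rw [LinearMap.finrank_range_of_inj hinj]
    simpa [Matrix.rank] using hcard)
  have hmem : X.mulVecLin b ∈ LinearMap.range (XS X T).mulVecLin := heq ▸ ⟨b, rfl⟩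
  exact hmem

/-- Two models are contained in the span of a nonsingular model whose size is at most the sum. -/
lemma exists_common_span (hX : ∀ S : Finset (Fin p), S.card ≤ X.rank → IsUnit (gram X S).det)
    (S S₀ : Finset (Fin p)) : ∃ T : Finset (Fin p), T.card ≤ X.rank ∧
      T.card ≤ S.card + S₀.card ∧ (∀ b, ∃ b', XS X T *ᵥ b' = XS X S *ᵥ b) ∧
      ∀ b, ∃ b', XS X T *ᵥ b' = XS X S₀ *ᵥ b := by
  by_cases hU : (S ∪ S₀).card ≤ X.rank
  · exact ⟨S ∪ S₀, hU, Finset.card_union_le _ _,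
      exists_XS_mulVec_eq_of_subset X Finset.subset_union_left,
      exists_XS_mulVec_eq_of_subset X Finset.subset_union_right⟩
  · obtain ⟨T, hTU, hT⟩ := Finset.exists_subset_card_eq (not_le.1 hU).le
    have hspan := exists_XS_mulVec_eq_of_card_eq_rank X (hX T hT.le) hT
    refine ⟨T, hT.le, (Finset.card_le_card hTU).trans (Finset.card_union_le _ _),
      fun b => ?_, fun b => ?_⟩ <;>
    · rw [← mulVec_augment]
      exact hspan _

end ColumnSpan

section PosteriorMass

lemma lintegral_Ioi_rpow_mul_exp {t x : ℝ} (ht : 0 < t) (hx : 0 < x) :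
    ∫⁻ u in Set.Ioi 0, ENNReal.ofReal (u ^ (t - 1) * Real.exp (-(x * u))) =
      ENNReal.ofReal (Real.Gamma t * x ^ (-t)) := by
  have h1 := Real.integral_rpow_mul_exp_neg_mul_Ioi ht hx
  have hpos : 0 < (1 / x) ^ t * Real.Gamma t :=
    mul_pos (Real.rpow_pos_of_pos (by positivity) _) (Real.Gamma_pos_of_pos ht)
  rw [← ofReal_integral_eq_lintegral_ofReal, h1, one_div, Real.inv_rpow hx.le,
    ← Real.rpow_neg hx.le, mul_comm]
  · by_contra hcon
    rw [integral_undef hcon] at h1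
    exact hpos.ne h1
  · refine (ae_restrict_mem measurableSet_Ioi).mono fun u hu => ?_
    have : (0 : ℝ) < u := hu
    positivity

/-- Total mass of a multivariate `t` kernel. -/
lemma lintegral_t_kernel {ι : Type*} [Fintype ι] [DecidableEq ι] {G : Matrix ι ι ℝ}
    (hG : G.PosDef) {m k A : ℝ} (hm : 0 < m) (hk : 0 < k) (hA : 0 < A) :
    ∫⁻ b : ι → ℝ, ENNReal.ofReal (Real.Gamma (m + Fintype.card ι / 2) *
        (A + k * (b ⬝ᵥ G *ᵥ b)) ^ (-(m + Fintype.card ι / 2))) =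
      ENNReal.ofReal ((π / k) ^ ((Fintype.card ι : ℝ) / 2) / √G.det *
        (Real.Gamma m * A ^ (-m))) := by
  set s : ℝ := (Fintype.card ι : ℝ) / 2 with hs
  have hs0 : 0 ≤ s := by positivity
  have hq : ∀ b : ι → ℝ, 0 ≤ b ⬝ᵥ G *ᵥ b := fun b => by
    simpa using hG.posSemidef.dotProduct_mulVec_nonneg b
  have hqm : Measurable fun b : ι → ℝ => b ⬝ᵥ G *ᵥ b := by
    unfold dotProduct mulVec dotProduct
    fun_prop
  have h1 : ∀ b : ι → ℝ, ENNReal.ofReal (Real.Gamma (m + s) *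
      (A + k * (b ⬝ᵥ G *ᵥ b)) ^ (-(m + s))) = ∫⁻ u in Set.Ioi 0, ENNReal.ofReal
        (u ^ (m + s - 1) * Real.exp (-((A + k * (b ⬝ᵥ G *ᵥ b)) * u))) := fun b =>
    (lintegral_Ioi_rpow_mul_exp (by positivity)
      (add_pos_of_pos_of_nonneg hA (mul_nonneg hk.le (hq b)))).symm
  simp_rw [h1]
  rw [lintegral_lintegral_swap]
  swap
  · refine Measurable.aemeasurable ?_
    unfold Function.uncurry
    have hqm' : Measurable fun z : (ι → ℝ) × ℝ => z.1 ⬝ᵥ G *ᵥ z.1 := hqm.comp measurable_fst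
    fun_prop
  have h2 : ∀ u ∈ Set.Ioi (0 : ℝ), ∫⁻ b : ι → ℝ, ENNReal.ofReal
        (u ^ (m + s - 1) * Real.exp (-((A + k * (b ⬝ᵥ G *ᵥ b)) * u))) =
      ENNReal.ofReal ((π / k) ^ s / √G.det) *
        ENNReal.ofReal (u ^ (m - 1) * Real.exp (-(A * u))) := by
    intro u hu
    have hu : 0 < u := hu
    have h3 : ∀ b : ι → ℝ, ENNReal.ofReal
        (u ^ (m + s - 1) * Real.exp (-((A + k * (b ⬝ᵥ G *ᵥ b)) * u))) =
        ENNReal.ofReal (u ^ (m + s - 1) * Real.exp (-(A * u))) *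
          ENNReal.ofReal (Real.exp (-(b ⬝ᵥ ((k * u) • G) *ᵥ b))) := by
      intro b
      rw [← ENNReal.ofReal_mul (by positivity), mul_assoc, ← Real.exp_add, smul_mulVec,
        dotProduct_smul, smul_eq_mul]
      congr 3
      ring
    simp_rw [h3]
    rw [lintegral_const_mul' _ _ ENNReal.ofReal_ne_top,
      lintegral_exp_neg_quadratic (hG.smul (by positivity)),
      ← ENNReal.ofReal_mul (by positivity), ← ENNReal.ofReal_mul (by positivity)]
    congr 1
    have hG' : 0 < √G.det := Real.sqrt_pos.2 hG.det_pos
    have hks : 0 < k ^ s := by positivity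
    have hus : 0 < u ^ s := by positivity
    rw [det_smul, Real.sqrt_mul (by positivity), sqrt_pow_eq_rpow (by positivity),
      ← sqrt_pow_eq_pow_sqrt Real.pi_pos.le, sqrt_pow_eq_rpow Real.pi_pos.le, ← hs,
      Real.mul_rpow hk.le hu.le, Real.div_rpow Real.pi_pos.le hk.le,
      show m + s - 1 = (m - 1) + s by ring, Real.rpow_add hu]
    field_simp
  rw [setLIntegral_congr_fun measurableSet_Ioi h2,
    lintegral_const_mul' _ _ ENNReal.ofReal_ne_top, lintegral_Ioi_rpow_mul_exp hm hA,
    ← ENNReal.ofReal_mul (by positivity)]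

lemma measurable_augment {p : ℕ} (S : Finset (Fin p)) : Measurable (augment S) := by
  refine measurable_pi_lambda _ fun j => ?_
  unfold augment
  split_ifs <;> fun_prop

variable {n p R : ℕ} {X : Matrix (Fin n) (Fin p) ℝ} {a₀ b₀ a c γ α : ℝ}

lemma priorWt_nonneg (hc : 0 < c) (S : Finset (Fin p)) : 0 ≤ priorWt p R a c S := by
  unfold priorWt
  split_ifs <;> positivity

lemma modelMeasure_univ (hX : ∀ S : Finset (Fin p), S.card ≤ R → IsUnit (gram X S).det)
    (ha₀ : 0 < a₀) (hb₀ : 0 < b₀) (hc : 0 < c) (hγ : 0 < γ) (hα : 0 < α) (y : Fin n → ℝ)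
    (S : Finset (Fin p)) :
    modelMeasure R X a₀ b₀ a c γ α y S Set.univ =
      ENNReal.ofReal (Real.Gamma (a₀ + α * n / 2) * modelWt R X a₀ b₀ a c γ α y S) := by
  rw [modelMeasure, Measure.map_apply (measurable_augment S) MeasurableSet.univ, Set.preimage_univ,
    withDensity_apply _ MeasurableSet.univ, Measure.restrict_univ]
  by_cases hS : S.card ≤ R
  swap
  · simp [Ddens, modelWt, priorWt, hS]
  set m : ℝ := a₀ + α * n / 2 with hm
  have hm0 : 0 < m := by positivity
  set A : ℝ := b₀ + α / 2 * rss X S y with hA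
  have hA0 : 0 < A := add_pos_of_pos_of_nonneg hb₀
    (mul_nonneg (by positivity) (rss_nonneg X S y))
  have hG := gram_posDef (hX S hS)
  have ht : tExp n α a₀ S.card = m + (Fintype.card {j // j ∈ S} : ℝ) / 2 := by
    rw [tExp, hm, Fintype.card_coe]
    ring
  have hpr : 0 ≤ priorWt p R a c S := priorWt_nonneg hc S
  set K : ℝ := priorWt p R a c S * (2 * π) ^ (-(S.card : ℝ) / 2) * √((γ • gram X S).det) with hK
  have hK0 : 0 ≤ K := by positivity
  have h1 : ∀ b, ENNReal.ofReal (Ddens R X a₀ b₀ a c γ α y S b) = ENNReal.ofReal K *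
      ENNReal.ofReal (Real.Gamma (m + (Fintype.card {j // j ∈ S} : ℝ) / 2) *
        (A + (α + γ) / 2 * ((b - betaHat X S y) ⬝ᵥ gram X S *ᵥ (b - betaHat X S y))) ^
          (-(m + (Fintype.card {j // j ∈ S} : ℝ) / 2))) := by
    intro b
    rw [← ENNReal.ofReal_mul hK0, Ddens, ht, hK, hA, quadForm]
    congr 1
    rw [add_right_comm b₀]
    ring
  simp_rw [h1]
  rw [lintegral_const_mul' _ _ ENNReal.ofReal_ne_top,
    lintegral_sub_right_eq_self (fun w => ENNReal.ofReal
      (Real.Gamma (m + (Fintype.card {j // j ∈ S} : ℝ) / 2) *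
        (A + (α + γ) / 2 * (w ⬝ᵥ gram X S *ᵥ w)) ^
          (-(m + (Fintype.card {j // j ∈ S} : ℝ) / 2)))) (betaHat X S y),
    lintegral_t_kernel hG hm0 (by positivity) hA0, ← ENNReal.ofReal_mul hK0]
  congr 1
  have hd : 0 < √(gram X S).det := Real.sqrt_pos.2 hG.det_pos
  rw [hK, det_smul, Fintype.card_coe, Real.sqrt_mul (by positivity), sqrt_pow_eq_rpow hγ.le,
    modelWt, ← hm, ← hA,
    neg_div, Real.rpow_neg (by positivity),
    show π / ((α + γ) / 2) = (2 * π) / (α + γ) by field_simp,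
    Real.div_rpow (by positivity) (by positivity), Real.div_rpow hγ.le (by positivity)]
  have h2 : 0 < (2 * π) ^ ((S.card : ℝ) / 2) := by positivity
  field_simp

lemma modelWt_nonneg (hb₀ : 0 < b₀) (hc : 0 < c) (hγ : 0 < γ) (hα : 0 < α) (y : Fin n → ℝ)
    (S : Finset (Fin p)) : 0 ≤ modelWt R X a₀ b₀ a c γ α y S := by
  have h1 := priorWt_nonneg (p := p) (R := R) (a := a) hc S
  have h2 := rss_nonneg X S y
  unfold modelWt
  positivity

lemma modelMeasure_support_ncard_ge_eq_zero (y : Fin n → ℝ) {S : Finset (Fin p)} {D : ℝ}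
    (hS : (S.card : ℝ) < D) :
    modelMeasure R X a₀ b₀ a c γ α y S {β | D ≤ ((Function.support β).ncard : ℝ)} = 0 := by
  have hV : MeasurableSet {β : Fin p → ℝ | ∃ j, j ∉ S ∧ β j ≠ 0} := by
    have : {β : Fin p → ℝ | ∃ j, j ∉ S ∧ β j ≠ 0} =
        ⋃ j : Fin p, ⋃ _ : j ∉ S, {β : Fin p → ℝ | β j ≠ 0} := by
      ext β
      simp
    rw [this]
    exact MeasurableSet.iUnion fun j => MeasurableSet.iUnion fun _ =>
      (measurableSet_eq_fun (measurable_pi_apply j) measurable_const).compl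
  refine measure_mono_null (t := {β : Fin p → ℝ | ∃ j, j ∉ S ∧ β j ≠ 0}) ?_ ?_
  · intro β hβ
    by_contra hcon
    have hsub : Function.support β ⊆ S := by
      intro j hj
      by_contra hjS
      exact hcon ⟨j, hjS, hj⟩
    have h1 : (Function.support β).ncard ≤ S.card := by
      simpa using Set.ncard_le_ncard hsub S.finite_toSet
    have h2 : D ≤ ((Function.support β).ncard : ℝ) := hβ
    have h3 : ((Function.support β).ncard : ℝ) ≤ S.card := by exact_mod_cast h1
    linarith
  · rw [modelMeasure, Measure.map_apply (measurable_augment S) hV]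
    have hempty : augment S ⁻¹' {β : Fin p → ℝ | ∃ j, j ∉ S ∧ β j ≠ 0} = ∅ := by
      refine Set.eq_empty_iff_forall_notMem.2 fun b hb => ?_
      obtain ⟨j, hj, hb⟩ := hb
      exact hb (by simp [augment, hj])
    rw [hempty, measure_empty]

lemma post_le_one (y : Fin n → ℝ) (B : Set (Fin p → ℝ)) :
    post R X a₀ b₀ a c γ α y B ≤ 1 := by
  rw [post, Measure.smul_apply, smul_eq_mul]
  exact (mul_le_mul_right (measure_mono (Set.subset_univ B)) _).trans
    (ENNReal.inv_mul_le_one _)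

/-- The posterior mass of large models is bounded by the sum of the weight ratios with respect
to a reference model. -/
lemma post_toReal_le_sum_ratio
    (hX : ∀ S : Finset (Fin p), S.card ≤ R → IsUnit (gram X S).det)
    (ha₀ : 0 < a₀) (hb₀ : 0 < b₀) (hc : 0 < c) (hγ : 0 < γ) (hα : 0 < α) (y : Fin n → ℝ)
    (S₀ : Finset (Fin p)) (h0 : 0 < modelWt R X a₀ b₀ a c γ α y S₀) (D : ℝ) :
    (post R X a₀ b₀ a c γ α y {β | D ≤ ((Function.support β).ncard : ℝ)}).toReal ≤
      ∑ S : Finset (Fin p) with D ≤ (S.card : ℝ),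
        modelWt R X a₀ b₀ a c γ α y S / modelWt R X a₀ b₀ a c γ α y S₀ := by
  set W := modelWt R X a₀ b₀ a c γ α y with hW
  have hWn : ∀ S, 0 ≤ W S := modelWt_nonneg hb₀ hc hγ hα y
  have hΓ : 0 < Real.Gamma (a₀ + α * n / 2) := Real.Gamma_pos_of_pos (by positivity)
  set g := Real.Gamma (a₀ + α * n / 2)
  have huniv := modelMeasure_univ (a := a) hX ha₀ hb₀ hc hγ hα y
  have hZ : ENNReal.ofReal (g * W S₀) ≤ postUnnorm R X a₀ b₀ a c γ α y Set.univ := by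
    rw [postUnnorm, Measure.finsetSum_apply, ← huniv S₀]
    exact Finset.single_le_sum (f := fun S => modelMeasure R X a₀ b₀ a c γ α y S Set.univ)
      (fun _ _ => zero_le) (Finset.mem_univ S₀)
  have hB : postUnnorm R X a₀ b₀ a c γ α y {β | D ≤ ((Function.support β).ncard : ℝ)} ≤
      ENNReal.ofReal (∑ S : Finset (Fin p) with D ≤ (S.card : ℝ), g * W S) := by
    rw [postUnnorm, Measure.finsetSum_apply,
      ENNReal.ofReal_sum_of_nonneg fun S _ => mul_nonneg hΓ.le (hWn S), Finset.sum_filter]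
    refine Finset.sum_le_sum fun S _ => ?_
    split_ifs with hS
    · rw [← huniv S]
      exact measure_mono (Set.subset_univ _)
    · exact (modelMeasure_support_ncard_ge_eq_zero y (not_le.1 hS)).le
  refine ENNReal.toReal_le_of_le_ofReal
    (Finset.sum_nonneg fun S _ => div_nonneg (hWn S) h0.le) ?_
  rw [post, Measure.smul_apply, smul_eq_mul]
  refine (mul_le_mul' (ENNReal.inv_le_inv.2 hZ) hB).trans ?_
  rw [← ENNReal.ofReal_inv_of_pos (by positivity), ← ENNReal.ofReal_mul (by positivity),
    Finset.mul_sum]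
  refine ENNReal.ofReal_le_ofReal (Finset.sum_le_sum fun S _ => le_of_eq ?_)
  field_simp

end PosteriorMass

section ExpectedPosterior

variable {n p : ℕ} {X : Matrix (Fin n) (Fin p) ℝ}

lemma integrable_integral_of_lintegral_ofReal {Ω : Type*} [MeasurableSpace Ω] {μ : Measure Ω}
    {f : Ω → ℝ} {r : ℝ} (hf : Measurable f) (hf0 : ∀ x, 0 ≤ f x) (hr : 0 ≤ r)
    (h : ∫⁻ x, ENNReal.ofReal (f x) ∂μ = ENNReal.ofReal r) :
    Integrable f μ ∧ ∫ x, f x ∂μ = r := by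
  refine ⟨⟨hf.aestronglyMeasurable, ?_⟩, ?_⟩
  · rw [hasFiniteIntegral_iff_ofReal (ae_of_all _ hf0), h]
    exact ENNReal.ofReal_lt_top
  · rw [integral_eq_lintegral_of_nonneg_ae (ae_of_all _ hf0) hf.aestronglyMeasurable, h,
      ENNReal.toReal_ofReal hr]

lemma integrable_integral_gaussVec_exp_projMat {S : Finset (Fin p)}
    (h : IsUnit (gram X S).det) (m : Fin n → ℝ)
    {v k u : ℝ} (hv : 0 < v) (hu : 0 ≤ u) (hk : 0 ≤ k) (huk : u < 1 + k) :
    Integrable (fun y => Real.exp (-(k * ((y - m) ⬝ᵥ (y - m)) -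
        u * ((y - m) ⬝ᵥ projMat X S *ᵥ (y - m))) / (2 * v))) (gaussVec n m v) ∧
      ∫ y, Real.exp (-(k * ((y - m) ⬝ᵥ (y - m)) -
        u * ((y - m) ⬝ᵥ projMat X S *ᵥ (y - m))) / (2 * v)) ∂(gaussVec n m v) =
      (√((1 + k) ^ n * (1 - u / (1 + k)) ^ S.card))⁻¹ := by
  refine integrable_integral_of_lintegral_ofReal ?_ (fun _ => (Real.exp_pos _).le)
    (by positivity) (lintegral_gaussVec_exp_projMat h m hv hu hk huk)
  unfold dotProduct mulVec dotProduct
  fun_prop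

lemma rpow_neg_div_rpow_neg_le_exp {b t r₀ r e w N m : ℝ} (hb : 0 < b) (ht : 0 < t)
    (hm : 0 ≤ m) (hr₀ : 0 ≤ r₀) (hN : 0 < N) (hw : 0 ≤ w) (h₀ : r₀ ≤ e) (hr : e - w ≤ r)
    (hNe : N ≤ e - w) :
    (b + t * r) ^ (-m) / (b + t * r₀) ^ (-m) ≤ Real.exp (m * (w / N)) := by
  have hA₀ : 0 < b + t * r₀ := by positivity
  have hrN : N ≤ r := hNe.trans hr
  have hA : 0 < b + t * r := by nlinarith
  rw [Real.rpow_neg hA.le, Real.rpow_neg hA₀.le, div_inv_eq_mul, inv_mul_eq_div,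
    ← Real.div_rpow hA₀.le hA.le, mul_comm m, Real.exp_mul]
  refine Real.rpow_le_rpow (by positivity) ?_ hm
  refine le_trans ?_ (Real.add_one_le_exp _)
  rw [div_add_one hN.ne', div_le_div_iff₀ hA hN]
  have h1 : r₀ ≤ r + w := by linarith
  have h2 : t * w * N ≤ t * w * r := by gcongr
  have h3 : t * r₀ * N ≤ t * (r + w) * N := by gcongr
  nlinarith [mul_nonneg hw hb.le]

/-- Pointwise comparison of model weights, on the event that the residuals of the full model
are not too small. -/
lemma modelWt_div_modelWt_le
    (hX : ∀ S : Finset (Fin p), S.card ≤ X.rank → IsUnit (gram X S).det)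
    {a₀ b₀ a c γ α v N ρ : ℝ} (ha₀ : 0 < a₀) (hb₀ : 0 < b₀) (hc : 0 < c) (hγ : 0 < γ)
    (hα : 0 < α) (hv : 0 < v) (hN : 0 < N) (hρ : (2 * a₀ + α * n) * v ≤ ρ * N)
    {β : Fin p → ℝ} {S₀ F S T : Finset (Fin p)} (hβ : ∀ j ∉ S₀, β j = 0)
    (hS₀ : S₀.card ≤ X.rank) (hF : F.card = X.rank) (hT : T.card ≤ X.rank)
    (hTS : ∀ b, ∃ b', XS X T *ᵥ b' = XS X S *ᵥ b)
    (hTS₀ : ∀ b, ∃ b', XS X T *ᵥ b' = XS X S₀ *ᵥ b) (y : Fin n → ℝ)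
    (hq : N ≤ (y - X *ᵥ β) ⬝ᵥ (y - X *ᵥ β) -
      (y - X *ᵥ β) ⬝ᵥ projMat X F *ᵥ (y - X *ᵥ β)) :
    modelWt X.rank X a₀ b₀ a c γ α y S / modelWt X.rank X a₀ b₀ a c γ α y S₀ ≤
      priorWt p X.rank a c S / priorWt p X.rank a c S₀ * (√(γ / (α + γ)))⁻¹ ^ S₀.card *
        Real.exp (-(0 * ((y - X *ᵥ β) ⬝ᵥ (y - X *ᵥ β)) -
          ρ * ((y - X *ᵥ β) ⬝ᵥ projMat X T *ᵥ (y - X *ᵥ β))) / (2 * v)) := by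
  set e := y - X *ᵥ β with he
  have hspan : ∃ b', XS X T *ᵥ b' = X *ᵥ β := by
    obtain ⟨b', hb'⟩ := hTS₀ fun j => β j.1
    exact ⟨b', by rw [hb', XS_mulVec_restrict X hβ]⟩
  have hrss : ∀ {U : Finset (Fin p)}, IsUnit (gram X U).det →
      (∃ b', XS X U *ᵥ b' = X *ᵥ β) → rss X U y = e ⬝ᵥ e - e ⬝ᵥ projMat X U *ᵥ e := by
    intro U hU hb
    obtain ⟨b', hb'⟩ := hb
    rw [← rss_eq_sub hU, ← rss_add_mulVec hU e b', hb', he, sub_add_cancel]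
  have hFX := exists_XS_mulVec_eq_of_card_eq_rank X (hX F hF.le) hF
  have hTr := hrss (hX T hT) hspan
  have hFr := hrss (hX F hF.le) (hFX β)
  have hFT : rss X F y ≤ rss X T y := by
    refine rss_le_rss (hX F hF.le) y fun b => ?_
    rw [← mulVec_augment]
    exact hFX _
  have hTle : rss X T y ≤ rss X S y := rss_le_rss (hX T hT) y hTS
  have hS₀le : rss X S₀ y ≤ e ⬝ᵥ e := by
    have h1 := rss_le (hX S₀ hS₀) y fun j => β j.1
    rwa [XS_mulVec_restrict X hβ] at h1
  have hw := dotProduct_projMat_nonneg (hX T hT) e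
  set w := e ⬝ᵥ projMat X T *ᵥ e with hwdef
  have hpow := rpow_neg_div_rpow_neg_le_exp (m := a₀ + α * n / 2) hb₀
    (show 0 < α / 2 by positivity) (by positivity) (rss_nonneg X S₀ y) hN hw hS₀le
    (hTr ▸ hTle) (by linarith)
  have hexp : Real.exp ((a₀ + α * n / 2) * (w / N)) ≤
      Real.exp (-(0 * (e ⬝ᵥ e) - ρ * w) / (2 * v)) := by
    refine Real.exp_le_exp.2 ?_
    rw [zero_mul, zero_sub, neg_neg, mul_div_assoc', div_le_div_iff₀ hN (by positivity)]
    nlinarith [mul_le_mul_of_nonneg_left hρ hw]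
  have hg1 : γ / (α + γ) ≤ 1 := (div_le_one (by positivity)).2 (by linarith)
  have hg : 0 < γ / (α + γ) := by positivity
  have hπ : 0 ≤ priorWt p X.rank a c S / priorWt p X.rank a c S₀ :=
    div_nonneg (priorWt_nonneg hc _) (priorWt_nonneg hc _)
  have hgS : (γ / (α + γ)) ^ ((S.card : ℝ) / 2) ≤ 1 :=
    Real.rpow_le_one hg.le hg1 (by positivity)
  have hgS₀ : (γ / (α + γ)) ^ ((S₀.card : ℝ) / 2) = √(γ / (α + γ)) ^ S₀.card := by
    rw [← sqrt_pow_eq_rpow hg.le, sqrt_pow_eq_pow_sqrt hg.le]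
  rw [modelWt, modelWt, hgS₀, mul_div_mul_comm, mul_div_mul_comm]
  refine mul_le_mul ?_ (hpow.trans hexp) ?_ (by positivity)
  · refine mul_le_mul_of_nonneg_left ?_ hπ
    rw [inv_pow, ← one_div]
    gcongr
  · have h1 := rss_nonneg X S y
    have h2 := rss_nonneg X S₀ y
    positivity

lemma priorWt_pos {R : ℕ} {a c : ℝ} (hc : 0 < c) (hp : 0 < p) {S : Finset (Fin p)}
    (hS : S.card ≤ R) : 0 < priorWt p R a c S := by
  have h1 : 0 < p.choose S.card :=
    Nat.choose_pos (by simpa using Finset.card_le_univ S)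
  have h2 : (0 : ℝ) < p := by exact_mod_cast hp
  rw [priorWt, if_pos hS]
  positivity

/-- Finite sample bound on the expected posterior mass of large models. -/
lemma integral_post_le
    (hX : ∀ S : Finset (Fin p), S.card ≤ X.rank → IsUnit (gram X S).det)
    {a₀ b₀ a c γ α v δ ρ k : ℝ} (ha₀ : 0 < a₀) (hb₀ : 0 < b₀) (hc : 0 < c) (hγ : 0 < γ)
    (hα : 0 < α) (hv : 0 < v) (hδ1 : δ < 1) (hρ0 : 0 ≤ ρ) (hρ1 : ρ < 1) (hk : 0 ≤ k)
    (hρ : 2 * a₀ + α * n ≤ ρ * ((1 - δ) * n)) (hn : 0 < n) (hp : 0 < p)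
    {β : Fin p → ℝ} {S₀ : Finset (Fin p)} (hβ : ∀ j ∉ S₀, β j = 0)
    (hS₀ : S₀.card ≤ X.rank) (D : ℝ) :
    ∫ y, (post X.rank X a₀ b₀ a c γ α y
        {β | D ≤ ((Function.support β).ncard : ℝ)}).toReal ∂(dataDist X β v) ≤
      Real.exp (k * ((1 - δ) * n) / 2) *
          (√((1 + k) ^ n * (1 - k / (1 + k)) ^ X.rank))⁻¹ +
        ∑ S : Finset (Fin p) with D ≤ (S.card : ℝ),
          priorWt p X.rank a c S / priorWt p X.rank a c S₀ * (√(γ / (α + γ)))⁻¹ ^ S₀.card *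
            (√(1 - ρ))⁻¹ ^ (S.card + S₀.card) := by
  obtain ⟨F, -, hF⟩ := Finset.exists_subset_card_eq (s := (Finset.univ : Finset (Fin p)))
    (n := X.rank) (by simpa using X.rank_le_width)
  choose T hTR hTc hTS hTS₀ using fun S => exists_common_span X hX S S₀
  have hn' : (0 : ℝ) < n := by exact_mod_cast hn
  have hN : 0 < (1 - δ) * n * v := by
    have : 0 < 1 - δ := by linarith
    positivity
  set m := X *ᵥ β with hm
  set r : Finset (Fin p) → ℝ := fun S =>
    priorWt p X.rank a c S / priorWt p X.rank a c S₀ * (√(γ / (α + γ)))⁻¹ ^ S₀.card with hr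
  have hr0 : ∀ S, 0 ≤ r S := fun S => mul_nonneg
    (div_nonneg (priorWt_nonneg hc _) (priorWt_nonneg hc _)) (by positivity)
  set f : Finset (Fin p) → ℝ → ℝ → (Fin n → ℝ) → ℝ := fun S k u y =>
    Real.exp (-(k * ((y - m) ⬝ᵥ (y - m)) -
      u * ((y - m) ⬝ᵥ projMat X S *ᵥ (y - m))) / (2 * v)) with hf
  have hpoint : ∀ y, (post X.rank X a₀ b₀ a c γ α y
      {β | D ≤ ((Function.support β).ncard : ℝ)}).toReal ≤
      Real.exp (k * ((1 - δ) * n) / 2) * f F k k y +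
        ∑ S : Finset (Fin p) with D ≤ (S.card : ℝ), r S * f (T S) 0 ρ y := by
    intro y
    have hsum0 : 0 ≤ ∑ S : Finset (Fin p) with D ≤ (S.card : ℝ), r S * f (T S) 0 ρ y :=
      Finset.sum_nonneg fun S _ => mul_nonneg (hr0 S) (Real.exp_pos _).le
    have hf0 : 0 ≤ Real.exp (k * ((1 - δ) * n) / 2) * f F k k y := by positivity
    rcases lt_or_ge ((y - m) ⬝ᵥ (y - m) - (y - m) ⬝ᵥ projMat X F *ᵥ (y - m))
      ((1 - δ) * n * v) with hq | hq
    · have h1 : (post X.rank X a₀ b₀ a c γ α y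
          {β | D ≤ ((Function.support β).ncard : ℝ)}).toReal ≤ 1 :=
        ENNReal.toReal_le_of_le_ofReal zero_le_one (by simpa using post_le_one y _)
      have h2 : 1 ≤ Real.exp (k * ((1 - δ) * n) / 2) * f F k k y := by
        rw [hf, ← Real.exp_add]
        refine Real.one_le_exp ?_
        rw [← mul_sub, show k * ((1 - δ) * n) / 2 = k * ((1 - δ) * n * v) / (2 * v) by
          field_simp, ← add_div]
        refine div_nonneg ?_ (by positivity)
        nlinarith
      linarith
    · have hW0 : 0 < modelWt X.rank X a₀ b₀ a c γ α y S₀ := by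
        have h1 := priorWt_pos (a := a) hc hp hS₀
        have h2 := rss_nonneg X S₀ y
        unfold modelWt
        positivity
      refine (post_toReal_le_sum_ratio hX ha₀ hb₀ hc hγ hα y S₀ hW0 D).trans ?_
      refine le_add_of_nonneg_of_le hf0 (Finset.sum_le_sum fun S _ => ?_)
      refine modelWt_div_modelWt_le hX ha₀ hb₀ hc hγ hα hv hN ?_ hβ hS₀ hF (hTR S) (hTS S)
        (hTS₀ S) y hq
      nlinarith
  have hFi := integrable_integral_gaussVec_exp_projMat (hX F hF.le) m hv hk hk
    (show k < 1 + k by linarith)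
  have hTi := fun S => integrable_integral_gaussVec_exp_projMat (hX (T S) (hTR S)) m hv hρ0
    le_rfl (show ρ < 1 + 0 by linarith)
  have hint : Integrable (fun y => ∑ S : Finset (Fin p) with D ≤ (S.card : ℝ),
      r S * f (T S) 0 ρ y) (gaussVec n m v) :=
    integrable_finsetSum _ fun S _ => (hTi S).1.const_mul _
  refine (integral_mono_of_nonneg (μ := gaussVec n m v) (ae_of_all _ fun _ => ENNReal.toReal_nonneg)
    ((hFi.1.const_mul _).add hint) (ae_of_all _ hpoint)).trans ?_
  rw [integral_add' (hFi.1.const_mul _) hint, integral_const_mul, hFi.2, hF,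
    integral_finsetSum _ fun S _ => (hTi S).1.const_mul _]
  refine add_le_add le_rfl (Finset.sum_le_sum fun S _ => ?_)
  rw [integral_const_mul, (hTi S).2]
  refine mul_le_mul_of_nonneg_left ?_ (hr0 S)
  have hρ' : 0 < 1 - ρ := by linarith
  rw [add_zero, one_pow, one_mul, div_one, sqrt_pow_eq_pow_sqrt hρ'.le, ← inv_pow]
  refine pow_le_pow_right₀ ?_ (hTc S)
  exact (one_le_inv₀ (Real.sqrt_pos.2 hρ')).2 (Real.sqrt_le_one.2 (by linarith))

end ExpectedPosterior

section Asymptotics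

lemma sum_priorWt_mul_pow_le {p R N : ℕ} {a c K : ℝ} (hc : 0 < c) (hp : 0 < p) (hK : 0 ≤ K)
    (hx : K / (c * (p : ℝ) ^ a) ≤ 1 / 2) :
    ∑ S : Finset (Fin p) with (N : ℝ) ≤ (S.card : ℝ), priorWt p R a c S * K ^ S.card ≤
      2 * (K / (c * (p : ℝ) ^ a)) ^ N := by
  have hp' : (0 : ℝ) < p := by exact_mod_cast hp
  set q : ℝ := c * (p : ℝ) ^ a with hq
  have hq0 : 0 < q := by positivity
  set x := K / q with hxdef
  have hx0 : 0 ≤ x := by positivity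
  set f : ℕ → ℝ := fun k => if N ≤ k then ((p.choose k : ℝ))⁻¹ * x ^ k else 0 with hf
  calc ∑ S : Finset (Fin p) with (N : ℝ) ≤ (S.card : ℝ), priorWt p R a c S * K ^ S.card
      ≤ ∑ S ∈ (Finset.univ : Finset (Fin p)).powerset, f S.card := by
        rw [Finset.sum_filter, Finset.powerset_univ]
        refine Finset.sum_le_sum fun S _ => ?_
        simp only [hf, Nat.cast_le]
        split_ifs
        · unfold priorWt
          split_ifs
          · rw [← hq, Real.rpow_neg hq0.le, Real.rpow_natCast, hxdef, div_pow]
            exact le_of_eq (by ring)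
          · rw [zero_mul]
            positivity
        · exact le_rfl
    _ = ∑ k ∈ Finset.Ico N (p + 1), x ^ k := by
        rw [Finset.sum_powerset_apply_card, Finset.card_univ, Fintype.card_fin,
          Finset.range_eq_Ico, ← Finset.sum_filter_add_sum_filter_not _ (fun k => N ≤ k)]
        rw [Finset.sum_eq_zero (s := Finset.filter (fun k => ¬ N ≤ k) _)
          fun k hk => by simp [hf, (Finset.mem_filter.1 hk).2], add_zero]
        have hset : Finset.filter (fun k => N ≤ k) (Finset.Ico 0 (p + 1)) =
            Finset.Ico N (p + 1) := by
          ext k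
          simp only [Finset.mem_filter, Finset.mem_Ico]
          omega
        rw [hset]
        refine Finset.sum_congr rfl fun k hk => ?_
        have hk' := Finset.mem_Ico.1 hk
        have hch : (p.choose k : ℝ) ≠ 0 := by
          exact_mod_cast (Nat.choose_pos (by omega)).ne'
        simp only [hf, if_pos hk'.1, nsmul_eq_mul]
        rw [mul_inv_cancel_left₀ hch]
    _ ≤ x ^ N / (1 - x) := geom_sum_Ico_le_of_lt_one hx0 (by linarith)
    _ ≤ 2 * x ^ N := by
        rw [div_le_iff₀ (by linarith)]
        nlinarith [pow_nonneg hx0 N]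

/-- Lower deviations of the residual sum of squares are exponentially unlikely. -/
lemma exp_mul_inv_sqrt_le {n R : ℕ} {k : ℝ} (hk0 : 0 < k) (hk1 : k ≤ 1) :
    Real.exp (k * ((1 - k) * n) / 2) * (√((1 + k) ^ n * (1 - k / (1 + k)) ^ R))⁻¹ ≤
      Real.exp (-(k ^ 3 / 4 * n) + R / 2) := by
  have h1 : 1 - k / (1 + k) = (1 + k)⁻¹ := by field_simp; ring
  have hL1 : Real.log (1 + k) ≤ k := by
    have := Real.log_le_sub_one_of_pos (show 0 < 1 + k by linarith)
    linarith
  have hL2 : k / (1 + k) ≤ Real.log (1 + k) := by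
    have := Real.one_sub_inv_le_log_of_pos (show 0 < 1 + k by linarith)
    linarith
  have h2 : √((1 + k) ^ n * (1 - k / (1 + k)) ^ R) =
      Real.exp ((n * Real.log (1 + k) - R * Real.log (1 + k)) / 2) := by
    rw [h1, Real.sqrt_eq_rpow, Real.rpow_def_of_pos (by positivity),
      Real.log_mul (by positivity) (by positivity), Real.log_pow, Real.log_pow, Real.log_inv]
    congr 1
    ring
  rw [h2, ← Real.exp_neg, ← Real.exp_add]
  refine Real.exp_le_exp.2 ?_
  have hn : (0 : ℝ) ≤ n := Nat.cast_nonneg n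
  have hR : (0 : ℝ) ≤ R := Nat.cast_nonneg R
  have h3 : k * (1 - k) / 2 + k ^ 3 / 4 ≤ Real.log (1 + k) / 2 := by
    have h4 : k * (1 - k) + k ^ 3 / 2 ≤ k / (1 + k) := by
      rw [le_div_iff₀ (by linarith)]
      nlinarith [pow_pos hk0 3]
    linarith
  nlinarith [mul_le_mul_of_nonneg_left h3 hn, mul_le_mul_of_nonneg_left (hL1.trans hk1) hR]

/-- The deterministic bound for the weight ratios, once `p` is large. -/
lemma sum_ratio_le_exp {p R C : ℕ} {a c h K : ℝ} (hc : 0 < c) (hp : 0 < p)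
    (hh : 0 ≤ h) (hK : 0 ≤ K) (hx : K / (c * (p : ℝ) ^ a) ≤ 1 / 2)
    (hx' : K / c ≤ (p : ℝ) ^ (a / 2)) (hcp : c * h * K ≤ p) (hC : 2 * (a + 5) ≤ a * C)
    {S₀ : Finset (Fin p)} (hS₀ : S₀.card ≤ R) :
    ∑ S : Finset (Fin p) with ((C * S₀.card : ℕ) : ℝ) ≤ (S.card : ℝ),
        priorWt p R a c S / priorWt p R a c S₀ * h ^ S₀.card * K ^ (S.card + S₀.card) ≤
      2 * Real.exp (-(3 * (S₀.card * Real.log p))) := by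
  have hp' : (0 : ℝ) < p := by exact_mod_cast hp
  set s := S₀.card with hs
  set q : ℝ := c * (p : ℝ) ^ a with hq
  have hq0 : 0 < q := by positivity
  have hL : 0 ≤ Real.log p := Real.log_natCast_nonneg p
  have hπ₀ := priorWt_pos (a := a) hc hp hS₀
  have hπinv : (priorWt p R a c S₀)⁻¹ = p.choose s * q ^ s := by
    rw [priorWt, if_pos hS₀, ← hs, ← hq, Real.rpow_neg hq0.le, Real.rpow_natCast, mul_inv,
      inv_inv, inv_inv]
  have hsum := sum_priorWt_mul_pow_le (R := R) (N := C * s) hc hp hK hx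
  have hpexp : ∀ t : ℝ, (p : ℝ) ^ t = Real.exp (Real.log p * t) := Real.rpow_def_of_pos hp'
  have hxle : K / q ≤ Real.exp (-(a / 2 * Real.log p)) := by
    rw [hq, ← div_div, div_le_iff₀ (by positivity)]
    refine hx'.trans (le_of_eq ?_)
    rw [hpexp, hpexp, ← Real.exp_add]
    congr 1
    ring
  have hqle : q * h * K ≤ Real.exp ((a + 1) * Real.log p) := by
    have h1 : q * h * K = (c * h * K) * (p : ℝ) ^ a := by rw [hq]; ring
    have h2 : Real.exp ((a + 1) * Real.log p) = p * (p : ℝ) ^ a := by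
      rw [mul_comm, ← hpexp, Real.rpow_add hp', Real.rpow_one, mul_comm]
    rw [h1, h2]
    gcongr
  have hch : (p.choose s : ℝ) ≤ Real.exp (Real.log p) ^ s := by
    rw [Real.exp_log hp']
    exact_mod_cast Nat.choose_le_pow p s
  calc ∑ S : Finset (Fin p) with ((C * s : ℕ) : ℝ) ≤ (S.card : ℝ),
        priorWt p R a c S / priorWt p R a c S₀ * h ^ s * K ^ (S.card + s)
      = p.choose s * (q * h * K) ^ s * ∑ S : Finset (Fin p) with
          ((C * s : ℕ) : ℝ) ≤ (S.card : ℝ), priorWt p R a c S * K ^ S.card := by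
        rw [Finset.mul_sum]
        refine Finset.sum_congr rfl fun S _ => ?_
        rw [div_eq_mul_inv, hπinv, pow_add, mul_pow, mul_pow]
        ring
    _ ≤ Real.exp (Real.log p) ^ s * Real.exp ((a + 1) * Real.log p) ^ s *
          (2 * Real.exp (-(a / 2 * Real.log p)) ^ (C * s)) := by
        have hx0 : 0 ≤ K / q := by positivity
        refine mul_le_mul ?_ (hsum.trans ?_) (Finset.sum_nonneg fun S _ => ?_) (by positivity)
        · exact mul_le_mul hch (pow_le_pow_left₀ (by positivity) hqle s) (by positivity)
            (by positivity)
        · gcongr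
        · exact mul_nonneg (priorWt_nonneg hc _) (by positivity)
    _ ≤ 2 * Real.exp (-(3 * (s * Real.log p))) := by
        rw [← Real.exp_nat_mul, ← Real.exp_nat_mul, ← Real.exp_nat_mul, ← Real.exp_add,
          mul_left_comm, ← Real.exp_add]
        gcongr
        push_cast
        have hsL : 0 ≤ (s : ℝ) * Real.log p := by positivity
        nlinarith [mul_le_mul_of_nonneg_left hC hsL]

lemma exp_add_two_mul_exp_le {x : ℝ} (hx : Real.log 2 ≤ x) :
    Real.exp (-(2 * x)) + 2 * Real.exp (-(3 * x)) ≤ Real.exp (-x) := by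
  have h2 : Real.exp (-(2 * x)) = Real.exp (-x) ^ 2 := by
    rw [← Real.exp_nat_mul]
    congr 1
    push_cast
    ring
  have h3 : Real.exp (-(3 * x)) = Real.exp (-x) ^ 3 := by
    rw [← Real.exp_nat_mul]
    congr 1
    push_cast
    ring
  have ht : Real.exp (-x) ≤ 1 / 2 := by
    rw [Real.exp_neg, one_div]
    refine inv_anti₀ two_pos ?_
    rw [← Real.exp_log two_pos]
    exact Real.exp_le_exp.2 hx
  have ht0 := Real.exp_pos (-x)
  rw [h2, h3]
  set t := Real.exp (-x)
  nlinarith [mul_nonneg ht0.le (show 0 ≤ (1 - 2 * t) * (1 + t) by nlinarith)]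

end Asymptotics

/-- Posterior dimension concentration (Theorem 1): under `s* ≤ R` and (A1)–(A3), there
are constants `C > 1` and `G > 0` such that with `Δ_n = C s*`,
`E_{β*}[Π^n({β : |S_β| ≥ Δ_n})] ≤ exp(−G s* log(p/s*))` for all large `n`. -/
theorem posterior_dimension_concentration
    (p R sstar : ℕ → ℕ) (X : ∀ n, Matrix (Fin n) (Fin (p n)) ℝ)
    (βstar : ∀ n, Fin (p n) → ℝ) (σ0sq : ℕ → ℝ) (a₀ b₀ a c γ α d₁ d₂ : ℝ)
    (ha₀ : 0 < a₀) (hb₀ : 0 < b₀) (ha : 0 < a) (hc : 0 < c) (hγ : 0 < γ)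
    (hα0 : 0 < α) (hα1 : α < 1)
    (hnp : ∀ n, n ≤ p n) (hptop : Tendsto (fun n => p n) atTop atTop)
    (hrank : ∀ n, (X n).rank = R n)
    (hinv : ∀ n (S : Finset (Fin (p n))), S.card ≤ R n → IsUnit (gram (X n) S).det)
    (hsstar : ∀ n, sstar n = (Function.support (βstar n)).ncard)
    (hsR : ∀ n, sstar n ≤ R n)
    (hd₁ : 0 < d₁) (hA1 : ∀ n, d₁ < σ0sq n ∧ σ0sq n < d₂)
    (hA2 : (fun n => (sstar n : ℝ) * Real.log (p n)) =o[atTop] fun n => (n : ℝ))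
    (hA3 : (fun n => (R n : ℝ) * Real.log (p n)) =o[atTop] fun n => (n : ℝ)) :
    ∃ C G : ℝ, 1 < C ∧ 0 < G ∧ ∀ᶠ n in atTop,
      (∫ y, ((post (R n) (X n) a₀ b₀ a c γ α y)
          {β : Fin (p n) → ℝ | C * sstar n ≤ ((Function.support β).ncard : ℝ)}).toReal
        ∂(dataDist (X n) (βstar n) (σ0sq n))) ≤
      Real.exp (-G * sstar n * Real.log ((p n : ℝ) / (sstar n : ℝ))) := by
  obtain ⟨C, hC⟩ := exists_nat_ge (2 * (a + 5) / a)
  have hCa : 2 * (a + 5) ≤ a * C := by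
    rw [div_le_iff₀ ha] at hC
    linarith
  have hC1 : (1 : ℝ) < C := by nlinarith
  set ρ : ℝ := (1 + α) / 2 with hρdef
  set δ : ℝ := (1 - α) / 4 with hδdef
  have hδ0 : 0 < δ := by linarith
  have hδ1 : δ < 1 := by linarith
  have hρ0 : 0 < ρ := by linarith
  have hρ1 : ρ < 1 := by linarith
  have hgap : 0 < ρ * (1 - δ) - α := by
    rw [hρdef, hδdef]
    nlinarith [mul_pos (show 0 < 1 - α by linarith) (show 0 < 3 - α by linarith)]
  set h : ℝ := (√(γ / (α + γ)))⁻¹ with hh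
  set K : ℝ := (√(1 - ρ))⁻¹ with hK
  have hpR : Tendsto (fun n => (p n : ℝ)) atTop atTop :=
    tendsto_natCast_atTop_atTop.comp hptop
  refine ⟨C, 1, hC1, one_pos, ?_⟩
  filter_upwards [eventually_gt_atTop 0, hptop.eventually_gt_atTop 0,
    (tendsto_natCast_atTop_atTop (R := ℝ)).eventually_ge_atTop
      (2 * a₀ / (ρ * (1 - δ) - α)),
    hpR.eventually_ge_atTop (c * h * K),
    ((tendsto_rpow_atTop (show 0 < a / 2 by positivity)).comp hpR).eventually_ge_atTop (K / c),
    ((tendsto_rpow_atTop ha).comp hpR).eventually_ge_atTop (2 * K / c),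
    (Real.tendsto_log_atTop.comp hpR).eventually_ge_atTop 1,
    hA3.bound (show 0 < δ ^ 3 / 10 by positivity)] with n hn hp h1 h2 h3 h4 h5 h6
  simp only [Function.comp_apply] at h3 h4 h5
  have hp' : (0 : ℝ) < p n := by exact_mod_cast hp
  have hXn : ∀ S : Finset (Fin (p n)), S.card ≤ (X n).rank → IsUnit (gram (X n) S).det := by
    rw [hrank n]
    exact hinv n
  set S₀ := suppFinset (βstar n) with hS₀
  have hS₀c : S₀.card = sstar n := by
    rw [hsstar n, ← Set.ncard_coe_finset]
    congr 1
    ext j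
    simp [hS₀, suppFinset]
  have hβ : ∀ j ∉ S₀, βstar n j = 0 := fun j hj => by simpa [hS₀, suppFinset] using hj
  have hv : 0 < σ0sq n := hd₁.trans (hA1 n).1
  have hS₀R : S₀.card ≤ (X n).rank := by
    rw [hS₀c, hrank n]
    exact hsR n
  have hρn : 2 * a₀ + α * n ≤ ρ * ((1 - δ) * n) := by
    rw [div_le_iff₀ hgap] at h1
    linarith
  rcases Nat.eq_zero_or_pos (sstar n) with hs | hs
  · rw [hs]
    have hle : ∀ y, ((post (R n) (X n) a₀ b₀ a c γ α y)
        {β : Fin (p n) → ℝ | (C : ℝ) * ((0 : ℕ) : ℝ) ≤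
          ((Function.support β).ncard : ℝ)}).toReal ≤ 1 := fun y =>
      ENNReal.toReal_le_of_le_ofReal zero_le_one (by simpa using post_le_one y _)
    have hprob : IsProbabilityMeasure (dataDist (X n) (βstar n) (σ0sq n)) := by
      unfold dataDist gaussVec
      infer_instance
    refine (integral_mono_of_nonneg (ae_of_all _ fun _ => ENNReal.toReal_nonneg)
      (integrable_const 1) (ae_of_all _ hle)).trans ?_
    simp
  have hbound := integral_post_le (a := a) hXn ha₀ hb₀ hc hγ hα0 hv hδ1 hρ0.le hρ1 hδ0.le hρn
    hn hp hβ hS₀R ((C * S₀.card : ℕ) : ℝ)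
  have hx : K / (c * (p n : ℝ) ^ a) ≤ 1 / 2 := by
    rw [div_le_iff₀ hc] at h4
    rw [div_le_iff₀ (by positivity)]
    linarith
  have hratio := sum_ratio_le_exp (C := C) hc hp (h := h) (by positivity) (K := K)
    (by positivity) hx h3 h2 hCa hS₀R
  have htail := exp_mul_inv_sqrt_le (n := n) (R := (X n).rank) hδ0 hδ1.le
  rw [hS₀c] at hbound hratio
  rw [hrank n] at hbound hratio htail
  have hs1 : (1 : ℝ) ≤ sstar n := by exact_mod_cast hs
  have hsR' : (sstar n : ℝ) ≤ R n := by exact_mod_cast hsR n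
  set L := Real.log (p n) with hL
  have h6' : (R n : ℝ) * L ≤ δ ^ 3 / 10 * n := by
    rw [Real.norm_of_nonneg (by positivity), Real.norm_of_nonneg (by positivity)] at h6
    exact h6
  have htail' : Real.exp (-(δ ^ 3 / 4 * n) + (R n : ℝ) / 2) ≤
      Real.exp (-(2 * (sstar n * L))) := by
    refine Real.exp_le_exp.2 ?_
    have h7 : (sstar n : ℝ) * L ≤ R n * L := by gcongr
    have h8 : (R n : ℝ) ≤ R n * L := le_mul_of_one_le_right (by positivity) h5
    linarith
  have hsL : Real.log 2 ≤ sstar n * L := by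
    have := Real.log_two_lt_d9
    nlinarith
  have hfin := exp_add_two_mul_exp_le hsL
  have hlog : Real.log ((p n : ℝ) / sstar n) ≤ L :=
    Real.log_le_log (by positivity) (div_le_self hp'.le hs1)
  have hgoal : Real.exp (-(sstar n * L)) ≤
      Real.exp (-1 * sstar n * Real.log ((p n : ℝ) / sstar n)) := by
    refine Real.exp_le_exp.2 ?_
    nlinarith
  push_cast at hbound hratio
  linarith

end EmpiricalBayes
end
end
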